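/- arXiv:2504.17184 — 3 statements merged into one kernel-verified Lean document; each statement's English description precedes it below -/
import Mathlib

section
/- Let d be an odd positive integer and n ≥ 2d+5. Then the rational number u_n = 2^{n-1} · [(d+2n)(d+2n+2)···(d+4n-2)] / [n(n+1)···(2n-1)] is not an integer. -/
namespace ChebAux

open Finset ArithmeticFunction Chebyshev

/-- Legendre-type identity for the logarithm of a factorial. -/
lemma log_fact (N : ℕ) : ∀ M : ℕ, M ≤ N →
    Real.log (M.factorial : ℝ) = ∑ k ∈ Ioc 0 N, vonMangoldt k * ((M / k : ℕ) : ℝ) := by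
  intro M
  induction M with
  | zero => intro _; simp
  | succ M ih =>
    intro h
    have h1 : ∑ k ∈ Ioc 0 N, vonMangoldt k * (((M + 1) / k : ℕ) : ℝ)
        = ∑ k ∈ Ioc 0 N, vonMangoldt k * ((M / k : ℕ) : ℝ)
          + ∑ k ∈ Ioc 0 N, if k ∣ M + 1 then vonMangoldt k else 0 := by
      rw [← sum_add_distrib]
      refine sum_congr rfl fun k _ => ?_
      rw [Nat.succ_div]
      split_ifs <;> push_cast <;> ring
    have h2 : (∑ k ∈ Ioc 0 N, if k ∣ M + 1 then vonMangoldt k else 0)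
        = Real.log ((M + 1 : ℕ) : ℝ) := by
      rw [← vonMangoldt_sum, ← sum_filter]
      refine sum_congr ?_ fun _ _ => rfl
      ext k
      simp only [mem_filter, mem_Ioc, Nat.mem_divisors]
      constructor
      · rintro ⟨_, h3⟩; exact ⟨h3, by omega⟩
      · rintro ⟨h3, _⟩
        exact ⟨⟨Nat.pos_of_dvd_of_pos h3 (by omega), (Nat.le_of_dvd (by omega) h3).trans h⟩, h3⟩
    rw [h1, h2, ← ih (by omega), Nat.factorial_succ, Nat.cast_mul, Real.log_mul (by positivity)
      (by positivity)]
    ring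

lemma log_step (k : ℕ) (hk : 1 ≤ k) :
    1 / ((k : ℝ) + 1) ≤ Real.log (k + 1) - Real.log k ∧
      Real.log (k + 1) - Real.log k ≤ 1 / (k : ℝ) := by
  have hk' : (0 : ℝ) < k := by exact_mod_cast hk
  rw [← Real.log_div (by positivity) (by positivity)]
  constructor
  · have := Real.one_sub_inv_le_log_of_pos (x := ((k : ℝ) + 1) / k) (by positivity)
    refine le_trans (le_of_eq ?_) this
    field_simp; ring
  · have := Real.log_le_sub_one_of_pos (x := ((k : ℝ) + 1) / k) (by positivity)
    refine le_trans this (le_of_eq ?_)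
    field_simp; ring

lemma fact_bounds (k : ℕ) (hk : 1 ≤ k) :
    (k : ℝ) * Real.log k - k + 1 ≤ Real.log (k.factorial : ℝ) ∧
    Real.log (k.factorial : ℝ) ≤ (k : ℝ) * Real.log k - k + 1 + Real.log k := by
  induction k, hk using Nat.le_induction with
  | base => simp
  | succ k hk ih =>
    obtain ⟨h1, h2⟩ := log_step k hk
    have hk' : (0 : ℝ) < k := by exact_mod_cast hk
    rw [Nat.factorial_succ, Nat.cast_mul, Real.log_mul (by positivity) (by positivity)]
    rw [div_le_iff₀ (by positivity)] at h1
    rw [le_div_iff₀ (by positivity)] at h2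
    push_cast
    constructor <;> nlinarith [ih.1, ih.2]

lemma f_mono {a b : ℝ} (ha : 1 ≤ a) (hab : a ≤ b) :
    a * Real.log a - a ≤ b * Real.log b - b := by
  have ha0 : 0 < a := by linarith
  have hb0 : 0 < b := by linarith
  have h1 := Real.log_le_sub_one_of_pos (x := a / b) (by positivity)
  rw [Real.log_div (by positivity) (by positivity)] at h1
  have h2 := Real.one_sub_inv_le_log_of_pos hb0
  have h3 : b * b⁻¹ = 1 := mul_inv_cancel₀ hb0.ne'
  have h4 : a / b = a * b⁻¹ := div_eq_mul_inv a b
  rw [h4] at h1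
  have hi : 0 < b⁻¹ := by positivity
  -- a log a ≤ a log b + a (a/b - 1)
  have h5 : a * Real.log a ≤ a * (Real.log b + (a * b⁻¹ - 1)) := by gcongr; linarith
  have h6 : 0 ≤ (b - a) * (Real.log b - (1 - a * b⁻¹)) := by
    apply mul_nonneg (by linarith)
    nlinarith
  have h7 : a * (a * b⁻¹) - a * 1 = (a - b) * (a * b⁻¹) + a * (b * b⁻¹) - a := by ring
  nlinarith

lemma fact_bounds_real (N j : ℕ) (hj : 1 ≤ j) (hN : 1 ≤ N) (x : ℝ) (hx : x = (N : ℝ) / j) :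
    x * Real.log x - x - Real.log (x + 1) ≤ Real.log ((N / j).factorial : ℝ) ∧
    Real.log ((N / j).factorial : ℝ) ≤ x * Real.log x - x + 1 + Real.log (x + 1) := by
  have hj' : (0 : ℝ) < j := by exact_mod_cast hj
  have hN' : (0 : ℝ) < N := by exact_mod_cast hN
  have hx0 : 0 < x := by rw [hx]; positivity
  have hfl : ((N / j : ℕ) : ℝ) ≤ x := by rw [hx]; exact Nat.cast_div_le
  have hfu : x < ((N / j : ℕ) : ℝ) + 1 := by
    rw [hx, div_lt_iff₀ hj']
    have h2 : N < (N / j + 1) * j := by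
      have := Nat.div_add_mod N j
      have := Nat.mod_lt N hj
      nlinarith
    exact_mod_cast h2
  generalize N / j = m at *
  have hl1 : 0 ≤ Real.log (x + 1) := Real.log_nonneg (by linarith)
  constructor
  · rcases lt_or_ge x 1 with h | h
    · have : Real.log x ≤ 0 := Real.log_nonpos hx0.le h.le
      have h3 : 0 ≤ Real.log (m.factorial : ℝ) := Real.log_natCast_nonneg _
      nlinarith
    · have h1 := (fact_bounds (m + 1) (by omega)).1
      rw [Nat.factorial_succ, Nat.cast_mul, Real.log_mul (by positivity) (by positivity)] at h1
      push_cast at h1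
      have h2 := f_mono h hfu.le
      have h3 : Real.log ((m : ℝ) + 1) ≤ Real.log (x + 1) := by gcongr
      linarith
  · rcases Nat.eq_zero_or_pos m with h | h
    · have h2 := Real.one_sub_inv_le_log_of_pos hx0
      have h3 : x * x⁻¹ = 1 := mul_inv_cancel₀ hx0.ne'
      rw [h]; simp
      nlinarith
    · have h1 := (fact_bounds m h).2
      have hm : (1 : ℝ) ≤ m := by exact_mod_cast h
      have h2 := f_mono hm hfl
      have h3 : Real.log (m : ℝ) ≤ Real.log (x + 1) := by
        apply Real.log_le_log <;> linarith
      linarith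

noncomputable def S (N : ℕ) : ℝ :=
  Real.log (N.factorial : ℝ) - Real.log ((N / 2).factorial : ℝ) - Real.log ((N / 3).factorial : ℝ)
    - Real.log ((N / 5).factorial : ℝ) + Real.log ((N / 30).factorial : ℝ)

noncomputable def A : ℝ := 14 / 30 * Real.log 2 + 9 / 30 * Real.log 3 + 5 / 30 * Real.log 5

lemma A_bounds : 0.92 ≤ A ∧ A ≤ 0.9275 := by
  have h2 := Real.log_two_gt_d9
  have h2' := Real.log_two_lt_d9
  -- 3^12 vs 2^19, 5^3 vs 2^7
  have a1 : 19 * Real.log 2 ≤ 12 * Real.log 3 := by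
    have := Real.log_le_log (x := (2 : ℝ) ^ 19) (y := 3 ^ 12) (by norm_num) (by norm_num)
    simpa [Real.log_pow] using this
  have a2 : 5 * Real.log 3 ≤ 8 * Real.log 2 := by
    have := Real.log_le_log (x := (3 : ℝ) ^ 5) (y := 2 ^ 8) (by norm_num) (by norm_num)
    simpa [Real.log_pow] using this
  have a3 : 3 * Real.log 5 ≤ 7 * Real.log 2 := by
    have := Real.log_le_log (x := (5 : ℝ) ^ 3) (y := 2 ^ 7) (by norm_num) (by norm_num)
    simpa [Real.log_pow] using this
  have a4 : 51 * Real.log 2 ≤ 22 * Real.log 5 := by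
    have := Real.log_le_log (x := (2 : ℝ) ^ 51) (y := 5 ^ 22) (by norm_num) (by norm_num)
    simpa [Real.log_pow] using this
  unfold A
  constructor <;> linarith

lemma S_bounds (N : ℕ) (hN : 1 ≤ N) :
    A * N - 3 - 5 * Real.log (N + 1) ≤ S N ∧ S N ≤ A * N + 2 + 5 * Real.log (N + 1) := by
  have hN' : (0 : ℝ) < N := by exact_mod_cast hN
  have key : ∀ j : ℕ, 1 ≤ j →
      (N : ℝ) / j * Real.log N - (N : ℝ) / j * Real.log j - (N : ℝ) / j - Real.log (N + 1)
        ≤ Real.log ((N / j).factorial : ℝ) ∧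
      Real.log ((N / j).factorial : ℝ) ≤
        (N : ℝ) / j * Real.log N - (N : ℝ) / j * Real.log j - (N : ℝ) / j + 1
          + Real.log (N + 1) := by
    intro j hj
    have hj' : (1 : ℝ) ≤ j := by exact_mod_cast hj
    have h := fact_bounds_real N j hj hN _ rfl
    rw [Real.log_div (by positivity) (by positivity)] at h
    have h3 : Real.log ((N : ℝ) / j + 1) ≤ Real.log (N + 1) := by
      gcongr
      exact div_le_self hN'.le hj'
    constructor <;> nlinarith [h.1, h.2]
  have k1 := key 1 (by norm_num)
  have k2 := key 2 (by norm_num)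
  have k3 := key 3 (by norm_num)
  have k5 := key 5 (by norm_num)
  have k30 := key 30 (by norm_num)
  have l30 : Real.log 30 = Real.log 2 + Real.log 3 + Real.log 5 := by
    rw [← Real.log_mul (by norm_num) (by norm_num), ← Real.log_mul (by norm_num) (by norm_num)]
    norm_num
  simp only [Nat.div_one, Nat.cast_one, Real.log_one, Nat.cast_ofNat, l30] at k1 k2 k3 k5 k30
  unfold S A
  constructor <;> linarith [k1.1, k1.2, k2.1, k2.2, k3.1, k3.2, k5.1, k5.2, k30.1, k30.2]

lemma psi_nat (N : ℕ) : psi (N : ℝ) = ∑ k ∈ Ioc 0 N, vonMangoldt k := by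
  simp [psi]

lemma S_eq (N : ℕ) : S N = ∑ k ∈ Ioc 0 N, vonMangoldt k *
    (((N / k : ℕ) : ℝ) - ((N / k / 2 : ℕ) : ℝ) - ((N / k / 3 : ℕ) : ℝ) - ((N / k / 5 : ℕ) : ℝ)
      + ((N / k / 30 : ℕ) : ℝ)) := by
  unfold S
  rw [log_fact N N le_rfl, log_fact N (N / 2) (Nat.div_le_self _ _),
    log_fact N (N / 3) (Nat.div_le_self _ _), log_fact N (N / 5) (Nat.div_le_self _ _),
    log_fact N (N / 30) (Nat.div_le_self _ _), ← sum_sub_distrib, ← sum_sub_distrib,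
    ← sum_sub_distrib, ← sum_add_distrib]
  refine sum_congr rfl fun k _ => ?_
  rw [Nat.div_right_comm N 2 k, Nat.div_right_comm N 3 k, Nat.div_right_comm N 5 k,
    Nat.div_right_comm N 30 k]
  ring

lemma S_le_psi (N : ℕ) : S N ≤ psi (N : ℝ) := by
  rw [S_eq, psi_nat]
  refine sum_le_sum fun k _ => ?_
  have h0 : 0 ≤ vonMangoldt k := vonMangoldt_nonneg
  have h1 : (((N / k : ℕ) : ℝ) - ((N / k / 2 : ℕ) : ℝ) - ((N / k / 3 : ℕ) : ℝ)
      - ((N / k / 5 : ℕ) : ℝ) + ((N / k / 30 : ℕ) : ℝ)) ≤ 1 := by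
    generalize N / k = q
    have : q + q / 30 ≤ 1 + q / 2 + q / 3 + q / 5 := by omega
    have : (q : ℝ) + (q / 30 : ℕ) ≤ 1 + (q / 2 : ℕ) + (q / 3 : ℕ) + (q / 5 : ℕ) := by
      exact_mod_cast this
    linarith
  nlinarith

lemma psi_sub_le_S (N : ℕ) : psi (N : ℝ) - psi ((N / 6 : ℕ) : ℝ) ≤ S N := by
  have hsub : ∑ k ∈ Ioc 0 (N / 6), vonMangoldt k
      = ∑ k ∈ Ioc 0 N, if k ≤ N / 6 then vonMangoldt k else 0 := by
    rw [← sum_filter]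
    refine sum_congr ?_ fun _ _ => rfl
    ext k
    simp only [mem_filter, mem_Ioc]
    omega
  rw [S_eq, psi_nat, psi_nat, hsub, ← sum_sub_distrib]
  refine sum_le_sum fun k hk => ?_
  rw [mem_Ioc] at hk
  have h0 : 0 ≤ vonMangoldt k := vonMangoldt_nonneg
  split_ifs with h
  · have h1 : 0 ≤ (((N / k : ℕ) : ℝ) - ((N / k / 2 : ℕ) : ℝ) - ((N / k / 3 : ℕ) : ℝ)
        - ((N / k / 5 : ℕ) : ℝ) + ((N / k / 30 : ℕ) : ℝ)) := by
      generalize N / k = q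
      have : q / 2 + q / 3 + q / 5 ≤ q + q / 30 := by omega
      have : ((q / 2 : ℕ) : ℝ) + (q / 3 : ℕ) + (q / 5 : ℕ) ≤ q + (q / 30 : ℕ) := by
        exact_mod_cast this
      linarith
    nlinarith
  · have h1 : 1 ≤ N / k := (Nat.one_le_div_iff hk.1).2 hk.2
    have h2 : N / k < 6 := by
      rw [Nat.div_lt_iff_lt_mul hk.1]
      omega
    have h3 : (((N / k : ℕ) : ℝ) - ((N / k / 2 : ℕ) : ℝ) - ((N / k / 3 : ℕ) : ℝ)
        - ((N / k / 5 : ℕ) : ℝ) + ((N / k / 30 : ℕ) : ℝ)) = 1 := by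
      generalize N / k = q at h1 h2
      interval_cases q <;> norm_num
    rw [h3]; linarith

lemma log_tangent (x : ℝ) (hx : 0 < x) (k : ℕ) :
    Real.log x ≤ x / 2 ^ k - 1 + k * Real.log 2 := by
  have := Real.log_le_sub_one_of_pos (x := x / 2 ^ k) (by positivity)
  rw [Real.log_div (by positivity) (by positivity), Real.log_pow] at this
  linarith

lemma psi_upper (N : ℕ) : psi (N : ℝ) ≤ 1.16 * N + 22 * (Nat.log 6 N + 1) := by
  induction N using Nat.strong_induction_on with
  | _ N ih =>
    rcases Nat.eq_zero_or_pos N with h | h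
    · subst h; simp
    · have h9 : psi ((N / 6 : ℕ) : ℝ) ≤ 1.16 * ((N / 6 : ℕ) : ℝ) + 22 * Nat.log 6 N := by
        rcases lt_or_ge N 6 with h6 | h6
        · rw [Nat.div_eq_of_lt h6, Nat.log_of_lt h6]; simp
        · have h3 := ih (N / 6) (by omega)
          rw [Nat.log_of_one_lt_of_le (by norm_num) h6]
          push_cast
          exact h3
      have h1 := psi_sub_le_S N
      have h2 := (S_bounds N h).2
      have h4 : ((N / 6 : ℕ) : ℝ) ≤ (N : ℝ) / 6 := Nat.cast_div_le
      have hN' : (0 : ℝ) < N := by exact_mod_cast h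
      have h5 := log_tangent ((N : ℝ) + 1) (by positivity) 7
      have h6 := Real.log_two_lt_d9
      have h7 := A_bounds.2
      have h8 : A * N ≤ 0.9275 * N := by gcongr
      norm_num at h5
      linarith

lemma exists_prime_large (n : ℕ) (hn : 200000 ≤ n) :
    ∃ p : ℕ, p.Prime ∧ 3 * (n - 1) < 2 * p ∧ p ≤ 2 * n - 1 := by
  by_contra! hcon
  have hth : theta ((2 * n - 1 : ℕ) : ℝ) = theta ((3 * (n - 1) / 2 : ℕ) : ℝ) := by
    unfold theta
    rw [Nat.floor_natCast, Nat.floor_natCast]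
    refine sum_congr ?_ fun _ _ => rfl
    ext p
    simp only [mem_filter, mem_Ioc]
    constructor
    · rintro ⟨⟨h1, h2⟩, h3⟩
      refine ⟨⟨h1, ?_⟩, h3⟩
      by_contra h4
      have := hcon p h3 (by omega)
      omega
    · rintro ⟨⟨h1, h2⟩, h3⟩
      exact ⟨⟨h1, by omega⟩, h3⟩
  have hY := psi_upper (3 * (n - 1) / 2)
  have hY2 := theta_le_psi ((3 * (n - 1) / 2 : ℕ) : ℝ)
  have hYX : 4 * ((3 * (n - 1) / 2 : ℕ) : ℝ) ≤ 3 * ((2 * n - 1 : ℕ) : ℝ) := by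
    have : 4 * (3 * (n - 1) / 2) ≤ 3 * (2 * n - 1) := by omega
    exact_mod_cast this
  have hXb : (399999 : ℝ) ≤ ((2 * n - 1 : ℕ) : ℝ) := by
    have : 399999 ≤ 2 * n - 1 := by omega
    exact_mod_cast this
  have hlogY : (Nat.log 6 (3 * (n - 1) / 2) : ℝ) ≤ Real.log ((2 * n - 1 : ℕ) : ℝ) := by
    have h1 : 6 ^ Nat.log 6 (3 * (n - 1) / 2) ≤ 3 * (n - 1) / 2 :=
      Nat.pow_log_le_self 6 (by omega)
    have h2 : 6 ^ Nat.log 6 (3 * (n - 1) / 2) ≤ 2 * n - 1 := by omega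
    have h3 : (6 : ℝ) ^ Nat.log 6 (3 * (n - 1) / 2) ≤ ((2 * n - 1 : ℕ) : ℝ) := by
      exact_mod_cast h2
    have h4 := Real.log_le_log (by positivity) h3
    rw [Real.log_pow] at h4
    have h5 : 1 ≤ Real.log 6 := by
      have h6 : Real.log ((2 : ℝ) ^ 2) ≤ Real.log 6 := Real.log_le_log (by norm_num) (by norm_num)
      rw [Real.log_pow] at h6
      have := Real.log_two_gt_d9
      push_cast at h6
      linarith
    nlinarith [Nat.cast_nonneg (α := ℝ) (Nat.log 6 (3 * (n - 1) / 2))]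
  have hS1 := S_le_psi (2 * n - 1)
  have hS2 := (S_bounds (2 * n - 1) (by omega)).1
  generalize (Nat.log 6 (3 * (n - 1) / 2) : ℝ) = L at *
  generalize ((3 * (n - 1) / 2 : ℕ) : ℝ) = Y at *
  generalize S (2 * n - 1) = s0 at *
  generalize ((2 * n - 1 : ℕ) : ℝ) = X at *
  have hX0 : 0 < X := by linarith
  have hpt := psi_sub_theta_le (x := X) (by linarith)
  have hA : 0.92 * X ≤ A * X := by
    have := A_bounds.1
    gcongr
  obtain ⟨s, hs⟩ : ∃ s, s = √X := ⟨_, rfl⟩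
  have hss : s * s = X := by rw [hs]; exact Real.mul_self_sqrt hX0.le
  have hs0 : 632 ≤ s := by
    rw [hs]; apply Real.le_sqrt_of_sq_le; linarith
  rw [← hs] at hpt
  have hlogX : Real.log X = 2 * Real.log s := by
    rw [← hss, Real.log_mul (by positivity) (by positivity)]; ring
  have hl2 := Real.log_two_lt_d9
  have hls := log_tangent s (by linarith) 10
  norm_num at hls
  have hls' : Real.log s ≤ s / 1024 + 5.932 := by linarith
  have hlX1 : Real.log (X + 1) ≤ Real.log 2 + Real.log X := by
    rw [← Real.log_mul (by norm_num) (by positivity)]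
    apply Real.log_le_log <;> linarith
  have h1 : 2 * s * Real.log X ≤ 4 * s * (s / 1024 + 5.932) := by
    rw [hlogX]
    nlinarith
  rw [hlogX] at hlX1 hlogY
  nlinarith

lemma exists_prime_mid (n : ℕ) (hn : 7 ≤ n) :
    ∃ p : ℕ, p.Prime ∧ 3 * (n - 1) < 2 * p ∧ p ≤ 2 * n - 1 := by
  by_cases h13 : 3 * n ≤ 2 * 13 + 2
  · exact ⟨13, by norm_num, by omega, by omega⟩
  by_cases h19 : 3 * n ≤ 2 * 19 + 2
  · exact ⟨19, by norm_num, by omega, by omega⟩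
  by_cases h23 : 3 * n ≤ 2 * 23 + 2
  · exact ⟨23, by norm_num, by omega, by omega⟩
  by_cases h31 : 3 * n ≤ 2 * 31 + 2
  · exact ⟨31, by norm_num, by omega, by omega⟩
  by_cases h43 : 3 * n ≤ 2 * 43 + 2
  · exact ⟨43, by norm_num, by omega, by omega⟩
  by_cases h59 : 3 * n ≤ 2 * 59 + 2
  · exact ⟨59, by norm_num, by omega, by omega⟩
  by_cases h79 : 3 * n ≤ 2 * 79 + 2
  · exact ⟨79, by norm_num, by omega, by omega⟩
  by_cases h107 : 3 * n ≤ 2 * 107 + 2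
  · exact ⟨107, by norm_num, by omega, by omega⟩
  by_cases h139 : 3 * n ≤ 2 * 139 + 2
  · exact ⟨139, by norm_num, by omega, by omega⟩
  by_cases h181 : 3 * n ≤ 2 * 181 + 2
  · exact ⟨181, by norm_num, by omega, by omega⟩
  by_cases h241 : 3 * n ≤ 2 * 241 + 2
  · exact ⟨241, by norm_num, by omega, by omega⟩
  by_cases h317 : 3 * n ≤ 2 * 317 + 2
  · exact ⟨317, by norm_num, by omega, by omega⟩
  by_cases h421 : 3 * n ≤ 2 * 421 + 2
  · exact ⟨421, by norm_num, by omega, by omega⟩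
  by_cases h563 : 3 * n ≤ 2 * 563 + 2
  · exact ⟨563, by norm_num, by omega, by omega⟩
  by_cases h751 : 3 * n ≤ 2 * 751 + 2
  · exact ⟨751, by norm_num, by omega, by omega⟩
  by_cases h997 : 3 * n ≤ 2 * 997 + 2
  · exact ⟨997, by norm_num, by omega, by omega⟩
  by_cases h1327 : 3 * n ≤ 2 * 1327 + 2
  · exact ⟨1327, by norm_num, by omega, by omega⟩
  by_cases h1759 : 3 * n ≤ 2 * 1759 + 2
  · exact ⟨1759, by norm_num, by omega, by omega⟩
  by_cases h2347 : 3 * n ≤ 2 * 2347 + 2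
  · exact ⟨2347, by norm_num, by omega, by omega⟩
  by_cases h3121 : 3 * n ≤ 2 * 3121 + 2
  · exact ⟨3121, by norm_num, by omega, by omega⟩
  by_cases h4159 : 3 * n ≤ 2 * 4159 + 2
  · exact ⟨4159, by norm_num, by omega, by omega⟩
  by_cases h5531 : 3 * n ≤ 2 * 5531 + 2
  · exact ⟨5531, by norm_num, by omega, by omega⟩
  by_cases h7369 : 3 * n ≤ 2 * 7369 + 2
  · exact ⟨7369, by norm_num, by omega, by omega⟩
  by_cases h9817 : 3 * n ≤ 2 * 9817 + 2
  · exact ⟨9817, by norm_num, by omega, by omega⟩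
  by_cases h13063 : 3 * n ≤ 2 * 13063 + 2
  · exact ⟨13063, by norm_num, by omega, by omega⟩
  by_cases h17419 : 3 * n ≤ 2 * 17419 + 2
  · exact ⟨17419, by norm_num, by omega, by omega⟩
  by_cases h23227 : 3 * n ≤ 2 * 23227 + 2
  · exact ⟨23227, by norm_num, by omega, by omega⟩
  by_cases h30971 : 3 * n ≤ 2 * 30971 + 2
  · exact ⟨30971, by norm_num, by omega, by omega⟩
  by_cases h41281 : 3 * n ≤ 2 * 41281 + 2
  · exact ⟨41281, by norm_num, by omega, by omega⟩
  by_cases h55021 : 3 * n ≤ 2 * 55021 + 2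
  · exact ⟨55021, by norm_num, by omega, by omega⟩
  by_cases h73363 : 3 * n ≤ 2 * 73363 + 2
  · exact ⟨73363, by norm_num, by omega, by omega⟩
  by_cases h97813 : 3 * n ≤ 2 * 97813 + 2
  · exact ⟨97813, by norm_num, by omega, by omega⟩
  by_cases h130411 : 3 * n ≤ 2 * 130411 + 2
  · exact ⟨130411, by norm_num, by omega, by omega⟩
  by_cases h173867 : 3 * n ≤ 2 * 173867 + 2
  · exact ⟨173867, by norm_num, by omega, by omega⟩
  by_cases h231823 : 3 * n ≤ 2 * 231823 + 2
  · exact ⟨231823, by norm_num, by omega, by omega⟩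
  by_cases h309091 : 3 * n ≤ 2 * 309091 + 2
  · exact ⟨309091, by norm_num, by omega, by omega⟩
  exact exists_prime_large n (by omega)

end ChebAux

/-- For odd `d` and `n ≥ 2d+5`,
`u_n = 2^{n-1} (d+2n)(d+2n+2)⋯(d+4n-2) / (n(n+1)⋯(2n-1))` is not an integer. -/
theorem stmt_7 (d n : ℕ) (hd : 0 < d) (hodd : Odd d) (hn : 2 * d + 5 ≤ n) :
    ¬ ∃ m : ℤ,
      (2 : ℚ) ^ (n - 1) * (∏ i ∈ Finset.range n, ((d : ℚ) + 2 * n + 2 * i)) /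
        (∏ i ∈ Finset.Ico n (2 * n), (i : ℚ)) = (m : ℚ) := by
  rintro ⟨m, hm⟩
  obtain ⟨p, hp, hp1, hp2⟩ := ChebAux.exists_prime_mid n (by omega)
  have hden : (∏ i ∈ Finset.Ico n (2 * n), (i : ℚ)) ≠ 0 := by
    refine Finset.prod_ne_zero_iff.2 fun i hi => ?_
    have := (Finset.mem_Ico.1 hi).1
    have : i ≠ 0 := by omega
    exact_mod_cast this
  rw [div_eq_iff hden] at hm
  have hm' : (2 : ℤ) ^ (n - 1) * (∏ i ∈ Finset.range n, ((d : ℤ) + 2 * n + 2 * i))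
      = m * ∏ i ∈ Finset.Ico n (2 * n), (i : ℤ) := by
    apply Int.cast_injective (α := ℚ)
    push_cast
    exact hm
  have hpI : Prime (p : ℤ) := Nat.prime_iff_prime_int.1 hp
  have hdvd : (p : ℤ) ∣ (2 : ℤ) ^ (n - 1) *
      (∏ i ∈ Finset.range n, ((d : ℤ) + 2 * n + 2 * i)) := by
    rw [hm']
    exact Dvd.dvd.mul_left (Finset.dvd_prod_of_mem (fun i : ℕ => (i : ℤ))
      (Finset.mem_Ico.2 ⟨by omega, by omega⟩)) m
  rcases hpI.dvd_or_dvd hdvd with h | h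
  · have h2 := hpI.dvd_of_dvd_pow h
    have h3 : p ∣ 2 := by exact_mod_cast h2
    have := Nat.le_of_dvd (by norm_num) h3
    omega
  · obtain ⟨i, hi, h2⟩ := hpI.exists_mem_finset_dvd h
    have hi := Finset.mem_range.1 hi
    have h3 : p ∣ d + 2 * n + 2 * i := by exact_mod_cast h2
    obtain ⟨c, hc⟩ := h3
    obtain ⟨e, he⟩ := hodd
    have c0 : c ≠ 0 := by rintro rfl; omega
    have c1 : c ≠ 1 := by rintro rfl; omega
    have c2 : c ≠ 2 := by rintro rfl; omega
    have c3 : 3 ≤ c := by omega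
    have : p * 3 ≤ p * c := Nat.mul_le_mul_left p c3
    omega
end

section
/- Let d be an odd positive integer and n ≥ 2d+9. Then the rational number u_n = [(d+2n+2)(d+2n+4)···(d+4n)] / (1·3·5···(2n+1)), when written in lowest terms, has a denominator with a prime factor different from 3; in particular u_n cannot be written as s/3^ℓ with s, ℓ integers. -/
open Chebyshev ArithmeticFunction in
theorem aux_log_factorial (K N : ℕ) (h : N ≤ K) :
    Real.log (N.factorial) = ∑ k ∈ Finset.Ioc 0 K, vonMangoldt k * ((N / k : ℕ) : ℝ) := by
  induction N with
  | zero => simp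
  | succ N ih =>
    rw [Nat.factorial_succ, Nat.cast_mul, Real.log_mul (by positivity) (by positivity), ih (by omega),
      ← vonMangoldt_sum]
    have h1 : (N + 1).divisors = (Finset.Ioc 0 K).filter (fun k => k ∣ N + 1) := by
      ext k
      simp only [Nat.mem_divisors, Finset.mem_filter, Finset.mem_Ioc]
      constructor
      · rintro ⟨a, -⟩
        have := Nat.le_of_dvd (by omega) a
        have := Nat.pos_of_dvd_of_pos a (by omega)
        exact ⟨⟨by omega, by omega⟩, a⟩
      · rintro ⟨-, a⟩
        exact ⟨a, by omega⟩
    rw [h1, Finset.sum_filter, ← Finset.sum_add_distrib]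
    refine Finset.sum_congr rfl fun k _ => ?_
    rw [Nat.succ_div]
    split_ifs <;> push_cast <;> ring

noncomputable def auxE (N : ℕ) : ℝ :=
  Real.log (N.factorial) - Real.log ((N / 2).factorial) - Real.log ((N / 3).factorial)
    - Real.log ((N / 5).factorial) + Real.log ((N / 30).factorial)

theorem auxE_eq (N : ℕ) : auxE N = ∑ k ∈ Finset.Ioc 0 N, ArithmeticFunction.vonMangoldt k *
    ((((N / k : ℕ) : ℤ) - ((N / k / 2 : ℕ) : ℤ) - ((N / k / 3 : ℕ) : ℤ) - ((N / k / 5 : ℕ) : ℤ)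
      + ((N / k / 30 : ℕ) : ℤ) : ℤ) : ℝ) := by
  unfold auxE
  rw [aux_log_factorial N N le_rfl, aux_log_factorial N (N / 2) (Nat.div_le_self _ _),
    aux_log_factorial N (N / 3) (Nat.div_le_self _ _),
    aux_log_factorial N (N / 5) (Nat.div_le_self _ _),
    aux_log_factorial N (N / 30) (Nat.div_le_self _ _),
    ← Finset.sum_sub_distrib, ← Finset.sum_sub_distrib, ← Finset.sum_sub_distrib,
    ← Finset.sum_add_distrib]
  refine Finset.sum_congr rfl fun k _ => ?_
  rw [Nat.div_div_eq_div_mul, Nat.div_div_eq_div_mul, Nat.div_div_eq_div_mul,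
    Nat.div_div_eq_div_mul, Nat.div_div_eq_div_mul, Nat.div_div_eq_div_mul,
    Nat.div_div_eq_div_mul, Nat.div_div_eq_div_mul, mul_comm k 2, mul_comm k 3, mul_comm k 5,
    mul_comm k 30]
  simp only [Int.cast_add, Int.cast_sub, Int.cast_natCast]
  ring

theorem aux_g (m : ℕ) : (m : ℤ) - ((m / 2 : ℕ) : ℤ) - ((m / 3 : ℕ) : ℤ) - ((m / 5 : ℕ) : ℤ)
      + ((m / 30 : ℕ) : ℤ) ≤ 1 ∧ 0 ≤ (m : ℤ) - ((m / 2 : ℕ) : ℤ) - ((m / 3 : ℕ) : ℤ)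
      - ((m / 5 : ℕ) : ℤ) + ((m / 30 : ℕ) : ℤ) := by
  obtain ⟨q, r, hr, rfl⟩ : ∃ q r, r < 30 ∧ m = 30 * q + r :=
    ⟨m / 30, m % 30, Nat.mod_lt _ (by norm_num), (Nat.div_add_mod m 30).symm⟩
  interval_cases r <;> omega

theorem auxE_le (N : ℕ) : auxE N ≤ Chebyshev.psi N := by
  rw [auxE_eq, Chebyshev.psi, Nat.floor_natCast]
  refine Finset.sum_le_sum fun k _ => ?_
  have h := (aux_g (N / k)).1
  have h' := ArithmeticFunction.vonMangoldt_nonneg (n := k)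
  have h2 := (Int.cast_le (R := ℝ)).2 h
  rw [Int.cast_one] at h2
  nlinarith

theorem le_auxE (N : ℕ) : Chebyshev.psi N ≤ auxE N + Chebyshev.psi ((N / 6 : ℕ) : ℝ) := by
  rw [auxE_eq, Chebyshev.psi, Chebyshev.psi, Nat.floor_natCast, Nat.floor_natCast]
  have h1 : Finset.Ioc 0 (N / 6) = (Finset.Ioc 0 N).filter (fun k => k ≤ N / 6) := by
    ext k
    simp only [Finset.mem_filter, Finset.mem_Ioc]
    omega
  rw [h1, Finset.sum_filter, ← Finset.sum_add_distrib]
  refine Finset.sum_le_sum fun k hk => ?_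
  rw [Finset.mem_Ioc] at hk
  have h' := ArithmeticFunction.vonMangoldt_nonneg (n := k)
  split_ifs with hc
  · have h2 := (Int.cast_le (R := ℝ)).2 (aux_g (N / k)).2
    rw [Int.cast_zero] at h2
    nlinarith
  · have a1 : 1 ≤ N / k := (Nat.one_le_div_iff hk.1).2 hk.2
    have a2 : N / k < 6 := by
      rw [Nat.div_lt_iff_lt_mul hk.1]
      omega
    generalize N / k = m at *
    have : (m : ℤ) - ((m / 2 : ℕ) : ℤ) - ((m / 3 : ℕ) : ℤ) - ((m / 5 : ℕ) : ℤ)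
      + ((m / 30 : ℕ) : ℤ) = 1 := by omega
    rw [this]
    simp

theorem aux_f_mono (a b : ℝ) (ha : 1 ≤ a) (hab : a ≤ b) :
    a * Real.log a - a ≤ b * Real.log b - b := by
  have ha0 : 0 < a := by linarith
  have hb : 0 < b := by linarith
  have h1 := Real.one_sub_inv_le_log_of_pos (x := b / a) (by positivity)
  rw [Real.log_div (by positivity) (by positivity), inv_div] at h1
  have h2 := Real.log_nonneg ha
  have h3 : b * (1 - a / b) = b - a := by field_simp
  have h4 := mul_le_mul_of_nonneg_left h1 hb.le
  nlinarith

theorem aux_fact_upper (m : ℕ) (hm : 1 ≤ m) :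
    Real.log (m.factorial) ≤ m * Real.log m - m + Real.log m + 1 := by
  induction m, hm using Nat.le_induction with
  | base => simp
  | succ n hn ih =>
    rw [Nat.factorial_succ, Nat.cast_mul, Real.log_mul (by positivity) (by positivity)]
    have hn' : (0 : ℝ) < n := by exact_mod_cast hn
    have h1 := Real.one_sub_inv_le_log_of_pos (x := ((n + 1 : ℕ) : ℝ) / n) (by positivity)
    rw [Real.log_div (by positivity) (by positivity), inv_div] at h1
    have h3 : ((n + 1 : ℕ) : ℝ) * (1 - n / ((n + 1 : ℕ) : ℝ)) = 1 := by
      field_simp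
      push_cast
      ring
    have h4 := mul_le_mul_of_nonneg_left h1 (by positivity : (0 : ℝ) ≤ ((n + 1 : ℕ) : ℝ))
    rw [h3] at h4
    push_cast at *
    nlinarith

theorem aux_fact_lower (m : ℕ) (hm : 1 ≤ m) :
    m * Real.log m - m ≤ Real.log (m.factorial) := by
  have h := Stirling.le_log_factorial_stirling (n := m) (by omega)
  have h1 : 0 ≤ Real.log m := Real.log_natCast_nonneg m
  have h2 : 0 ≤ Real.log (2 * Real.pi) := Real.log_nonneg (by linarith [Real.pi_gt_three])
  linarith

theorem aux_div_bounds (N k : ℕ) (hk : 0 < k) (hk2 : k ≤ 30) (hN : 60 ≤ N) :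
    Real.log ((N / k).factorial) ≤
      (N / k : ℝ) * (Real.log N - Real.log k) - N / k + Real.log N + 1 ∧
    (N / k : ℝ) * (Real.log N - Real.log k) - N / k - Real.log N - 1 ≤
      Real.log ((N / k).factorial) := by
  have hk' : (0 : ℝ) < k := by exact_mod_cast hk
  have hN' : (0 : ℝ) < N := by exact_mod_cast (by omega : 0 < N)
  have hm : 1 ≤ N / k := by
    rw [Nat.one_le_div_iff hk]; omega
  have hm' : (1 : ℝ) ≤ ((N / k : ℕ) : ℝ) := by exact_mod_cast hm
  have hle : ((N / k : ℕ) : ℝ) ≤ (N : ℝ) / k := Nat.cast_div_le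
  have hge : (N : ℝ) / k ≤ ((N / k + 1 : ℕ) : ℝ) := by
    rw [div_le_iff₀ hk']
    have := Nat.lt_div_mul_add (a := N) hk
    have h2 : N ≤ (N / k + 1) * k := by rw [add_mul]; omega
    exact_mod_cast h2
  have hmN : ((N / k : ℕ) : ℝ) ≤ N := by exact_mod_cast Nat.div_le_self N k
  have hl : Real.log ((N / k : ℕ) : ℝ) ≤ Real.log N := Real.log_le_log (by positivity) hmN
  rw [← Real.log_div (by positivity) (by positivity)]
  constructor
  · have h1 := aux_fact_upper (N / k) hm
    have h2 := aux_f_mono _ _ hm' hle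
    linarith
  · have h1 := aux_fact_lower (N / k + 1) (by omega)
    have h2 := aux_f_mono _ _ (hm'.trans hle) hge
    rw [Nat.factorial_succ, Nat.cast_mul, Real.log_mul (by positivity) (by positivity)] at h1
    have h3 : Real.log ((N / k + 1 : ℕ) : ℝ) ≤ Real.log N + 1 := by
      have : ((N / k + 1 : ℕ) : ℝ) ≤ N * Real.exp 1 := by
        have := Real.add_one_le_exp (1 : ℝ)
        push_cast
        nlinarith
      have h4 := Real.log_le_log (by positivity) this
      rwa [Real.log_mul (by positivity) (by positivity), Real.log_exp] at h4
    linarith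

noncomputable def auxA : ℝ :=
  (14 / 30) * Real.log 2 + (9 / 30) * Real.log 3 + (5 / 30) * Real.log 5

theorem auxE_bounds (N : ℕ) (hN : 60 ≤ N) :
    auxE N ≤ auxA * N + 5 * Real.log N + 5 ∧ auxA * N - 5 * Real.log N - 5 ≤ auxE N := by
  have h1 := aux_div_bounds N 1 (by norm_num) (by norm_num) hN
  have h2 := aux_div_bounds N 2 (by norm_num) (by norm_num) hN
  have h3 := aux_div_bounds N 3 (by norm_num) (by norm_num) hN
  have h5 := aux_div_bounds N 5 (by norm_num) (by norm_num) hN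
  have h30 := aux_div_bounds N 30 (by norm_num) (by norm_num) hN
  have e : Real.log 30 = Real.log 2 + Real.log 3 + Real.log 5 := by
    rw [← Real.log_mul (by norm_num) (by norm_num), ← Real.log_mul (by norm_num) (by norm_num)]
    norm_num
  simp only [Nat.div_one, Nat.cast_one, Real.log_one, div_one, sub_zero, Nat.cast_ofNat, e] at h1 h2 h3 h5 h30
  unfold auxE auxA
  constructor <;> linarith [h1.1, h1.2, h2.1, h2.2, h3.1, h3.2, h5.1, h5.2, h30.1, h30.2]

theorem auxA_lower : Real.log 2 + 0.22 ≤ auxA := by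
  have h3 : 11 * Real.log 2 ≤ 7 * Real.log 3 := by
    have := Real.log_le_log (by norm_num) (by norm_num : (2 : ℝ) ^ 11 ≤ 3 ^ 7)
    rw [Real.log_pow, Real.log_pow] at this
    exact_mod_cast this
  have h5 : 16 * Real.log 2 ≤ 7 * Real.log 5 := by
    have := Real.log_le_log (by norm_num) (by norm_num : (2 : ℝ) ^ 16 ≤ 5 ^ 7)
    rw [Real.log_pow, Real.log_pow] at this
    exact_mod_cast this
  have := Real.log_two_gt_d9
  unfold auxA
  linarith

theorem aux_large (N : ℕ) (hN : 1000000 ≤ N) : ∃ p, p.Prime ∧ 3 * N < 4 * p ∧ p ≤ N := by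
  by_contra! hcon
  set M := 3 * N / 4 with hM
  have hMN : M ≤ N := by omega
  have hth : Chebyshev.theta N = Chebyshev.theta M := by
    rw [Chebyshev.theta, Chebyshev.theta, Nat.floor_natCast, Nat.floor_natCast]
    congr 1
    ext p
    simp only [Finset.mem_filter, Finset.mem_Ioc]
    constructor
    · rintro ⟨⟨a, b⟩, c⟩
      refine ⟨⟨a, ?_⟩, c⟩
      by_contra hc
      have := hcon p c (by omega)
      omega
    · rintro ⟨⟨a, b⟩, c⟩
      exact ⟨⟨a, by omega⟩, c⟩
  have hNr : (1000000 : ℝ) ≤ N := by exact_mod_cast hN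
  have hMr : (M : ℝ) ≤ 3 / 4 * N := by
    have : 4 * M ≤ 3 * N := by omega
    have : (4 : ℝ) * M ≤ 3 * N := by exact_mod_cast this
    linarith
  have hKr : ((M / 6 : ℕ) : ℝ) ≤ N / 8 := by
    have : 8 * (M / 6) ≤ N := by omega
    have : (8 : ℝ) * ((M / 6 : ℕ) : ℝ) ≤ N := by exact_mod_cast this
    linarith
  have hM1 : 60 ≤ M := by omega
  have hK1 : (1 : ℝ) ≤ ((M / 6 : ℕ) : ℝ) := by exact_mod_cast (by omega : 1 ≤ M / 6)
  have b1 := (auxE_bounds N (by omega)).2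
  have b2 := auxE_le N
  have b3 := le_auxE M
  have b4 := (auxE_bounds M hM1).1
  have b5 := Chebyshev.psi_le hK1
  have b6 := (abs_le.1 (Chebyshev.abs_psi_sub_theta_le_sqrt_mul_log (x := N) (by linarith))).2
  have b7 := Chebyshev.theta_le_psi M
  have hA := auxA_lower
  set s := Real.sqrt N with hs
  have hss : s * s = N := Real.mul_self_sqrt (by linarith)
  have hs1 : 1000 ≤ s := Real.le_sqrt_of_sq_le (by linarith)
  have hKs : Real.sqrt ((M / 6 : ℕ) : ℝ) ≤ s / 2 := by
    apply Real.sqrt_le_iff.2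
    constructor
    · linarith
    · nlinarith
  have hlM : Real.log M ≤ Real.log N :=
    Real.log_le_log (by exact_mod_cast (by omega : 0 < M)) (by exact_mod_cast hMN)
  have hlK : Real.log ((M / 6 : ℕ) : ℝ) ≤ Real.log N :=
    Real.log_le_log (by linarith) (by linarith)
  have hlK0 : 0 ≤ Real.log ((M / 6 : ℕ) : ℝ) := Real.log_nonneg hK1
  have hlN : Real.log N ≤ s / 500 + 11.87 := by
    rw [← hss, Real.log_mul (by positivity) (by positivity)]
    have h1 := Real.log_le_sub_one_of_pos (x := s / 1000) (by positivity)
    rw [Real.log_div (by positivity) (by positivity)] at h1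
    have h2 : Real.log 1000 ≤ 10 * Real.log 2 := by
      have := Real.log_le_log (by norm_num) (by norm_num : (1000 : ℝ) ≤ 2 ^ 10)
      rw [Real.log_pow] at this
      exact_mod_cast this
    have := Real.log_two_lt_d9
    linarith
  have hl4 : Real.log 4 = 2 * Real.log 2 := by
    rw [show (4 : ℝ) = 2 ^ 2 by norm_num, Real.log_pow]
    norm_num
  have c1 : 2 * Real.sqrt ((M / 6 : ℕ) : ℝ) * Real.log ((M / 6 : ℕ) : ℝ) ≤ s * Real.log N := by
    have := mul_le_mul hKs hlK hlK0 (by linarith)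
    linarith
  have hl2 : 0 < Real.log 2 := Real.log_pos (by norm_num)
  have c2 : Real.log 4 * ((M / 6 : ℕ) : ℝ) ≤ Real.log 2 * N / 4 := by
    rw [hl4]
    nlinarith
  have c3 : auxA * M ≤ auxA * (3 / 4 * N) := mul_le_mul_of_nonneg_left hMr (by linarith)
  have c4 : (Real.log 2 + 0.22) * N ≤ auxA * N := mul_le_mul_of_nonneg_right hA (by linarith)
  have c5 : s * Real.log N ≤ s * (s / 500 + 11.87) := mul_le_mul_of_nonneg_left hlN (by linarith)
  have key : 0.055 * (N : ℝ) ≤ 3 * (s * Real.log N) + 10 * Real.log N + 10 := by linarith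
  have key2 : 0.055 * (s * s) ≤ 3 * (s * (s / 500 + 11.87)) + 10 * (s / 500 + 11.87) + 10 := by
    rw [hss]
    linarith
  nlinarith

theorem aux_prime (N : ℕ) (hN : 23 ≤ N) : ∃ p, p.Prime ∧ 3 * N < 4 * p ∧ p ≤ N := by
  by_cases h : 1000000 ≤ N
  · exact aux_large N h
  by_cases h31 : N < 31
  · exact ⟨23, by norm_num, by omega, by omega⟩
  by_cases h41 : N < 41
  · exact ⟨31, by norm_num, by omega, by omega⟩
  by_cases h53 : N < 53
  · exact ⟨41, by norm_num, by omega, by omega⟩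
  by_cases h71 : N < 71
  · exact ⟨53, by norm_num, by omega, by omega⟩
  by_cases h89 : N < 89
  · exact ⟨71, by norm_num, by omega, by omega⟩
  by_cases h113 : N < 113
  · exact ⟨89, by norm_num, by omega, by omega⟩
  by_cases h151 : N < 151
  · exact ⟨113, by norm_num, by omega, by omega⟩
  by_cases h199 : N < 199
  · exact ⟨151, by norm_num, by omega, by omega⟩
  by_cases h263 : N < 263
  · exact ⟨199, by norm_num, by omega, by omega⟩
  by_cases h349 : N < 349
  · exact ⟨263, by norm_num, by omega, by omega⟩
  by_cases h463 : N < 463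
  · exact ⟨349, by norm_num, by omega, by omega⟩
  by_cases h617 : N < 617
  · exact ⟨463, by norm_num, by omega, by omega⟩
  by_cases h823 : N < 823
  · exact ⟨617, by norm_num, by omega, by omega⟩
  by_cases h1097 : N < 1097
  · exact ⟨823, by norm_num, by omega, by omega⟩
  by_cases h1459 : N < 1459
  · exact ⟨1097, by norm_num, by omega, by omega⟩
  by_cases h1933 : N < 1933
  · exact ⟨1459, by norm_num, by omega, by omega⟩
  by_cases h2557 : N < 2557
  · exact ⟨1933, by norm_num, by omega, by omega⟩
  by_cases h3407 : N < 3407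
  · exact ⟨2557, by norm_num, by omega, by omega⟩
  by_cases h4523 : N < 4523
  · exact ⟨3407, by norm_num, by omega, by omega⟩
  by_cases h6029 : N < 6029
  · exact ⟨4523, by norm_num, by omega, by omega⟩
  by_cases h8039 : N < 8039
  · exact ⟨6029, by norm_num, by omega, by omega⟩
  by_cases h10711 : N < 10711
  · exact ⟨8039, by norm_num, by omega, by omega⟩
  by_cases h14281 : N < 14281
  · exact ⟨10711, by norm_num, by omega, by omega⟩
  by_cases h19037 : N < 19037
  · exact ⟨14281, by norm_num, by omega, by omega⟩
  by_cases h25373 : N < 25373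
  · exact ⟨19037, by norm_num, by omega, by omega⟩
  by_cases h33829 : N < 33829
  · exact ⟨25373, by norm_num, by omega, by omega⟩
  by_cases h45083 : N < 45083
  · exact ⟨33829, by norm_num, by omega, by omega⟩
  by_cases h60107 : N < 60107
  · exact ⟨45083, by norm_num, by omega, by omega⟩
  by_cases h80141 : N < 80141
  · exact ⟨60107, by norm_num, by omega, by omega⟩
  by_cases h106853 : N < 106853
  · exact ⟨80141, by norm_num, by omega, by omega⟩
  by_cases h142469 : N < 142469
  · exact ⟨106853, by norm_num, by omega, by omega⟩
  by_cases h189949 : N < 189949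
  · exact ⟨142469, by norm_num, by omega, by omega⟩
  by_cases h253247 : N < 253247
  · exact ⟨189949, by norm_num, by omega, by omega⟩
  by_cases h337661 : N < 337661
  · exact ⟨253247, by norm_num, by omega, by omega⟩
  by_cases h450209 : N < 450209
  · exact ⟨337661, by norm_num, by omega, by omega⟩
  by_cases h600269 : N < 600269
  · exact ⟨450209, by norm_num, by omega, by omega⟩
  by_cases h800357 : N < 800357
  · exact ⟨600269, by norm_num, by omega, by omega⟩
  by_cases h1067137 : N < 1067137
  · exact ⟨800357, by norm_num, by omega, by omega⟩
  omega

theorem aux_dvd_doubleFactorial (n p : ℕ) (h : Odd p) (hp : p ≤ 2 * n + 1) :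
    p ∣ Nat.doubleFactorial (2 * n + 1) := by
  induction n with
  | zero =>
    obtain ⟨k, rfl⟩ := h
    have : k = 0 := by omega
    subst this
    simp
  | succ n ih =>
    rw [show 2 * (n + 1) + 1 = (2 * n + 1) + 2 by ring, Nat.doubleFactorial_add_two]
    by_cases h1 : p ≤ 2 * n + 1
    · exact (ih h1).mul_left _
    · obtain ⟨k, rfl⟩ := h
      have : 2 * k + 1 = 2 * n + 1 + 2 := by omega
      rw [this]
      exact dvd_mul_right _ _

/-- For odd `d` and `n ≥ 2d+9`, the denominator of
`u_n = (d+2n+2)(d+2n+4)⋯(d+4n) / (1·3⋯(2n+1))` (in lowest terms)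
has a prime factor different from `3`; in particular `u_n ≠ s/3^ℓ`. -/
theorem stmt_8 (d n : ℕ) (hd : 0 < d) (hodd : Odd d) (hn : 2 * d + 9 ≤ n) :
    (∃ p : ℕ, p.Prime ∧ p ≠ 3 ∧
      p ∣ ((∏ i ∈ Finset.range n, ((d : ℚ) + 2 * n + 2 + 2 * i)) /
        (Nat.doubleFactorial (2 * n + 1) : ℚ)).den) ∧
    ¬ ∃ (s : ℤ) (ℓ : ℕ),
      (∏ i ∈ Finset.range n, ((d : ℚ) + 2 * n + 2 + 2 * i)) /
        (Nat.doubleFactorial (2 * n + 1) : ℚ) = (s : ℚ) / 3 ^ ℓ := by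
  obtain ⟨p, hp, h1, h2⟩ := aux_prime (2 * n + 1) (by omega)
  have hpodd : Odd p := hp.odd_of_ne_two (by omega)
  have hD := aux_dvd_doubleFactorial n p hpodd h2
  have hP : ¬ p ∣ ∏ i ∈ Finset.range n, (d + 2 * n + 2 + 2 * i) := by
    rw [hp.prime.dvd_finsetProd_iff]
    rintro ⟨i, hi, c, hc⟩
    rw [Finset.mem_range] at hi
    have c1 : 1 < c := by
      by_contra hh
      have : p * c ≤ p * 1 := Nat.mul_le_mul_left _ (by omega)
      omega
    have c2 : c < 3 := by
      by_contra hh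
      have : p * 3 ≤ p * c := Nat.mul_le_mul_left _ (by omega)
      omega
    have c3 : c = 2 := by omega
    subst c3
    obtain ⟨k, rfl⟩ := hodd
    omega
  have hPc : (∏ i ∈ Finset.range n, ((d : ℚ) + 2 * n + 2 + 2 * i)) =
      ((∏ i ∈ Finset.range n, (d + 2 * n + 2 + 2 * i) : ℕ) : ℚ) := by
    push_cast
    rfl
  rw [hPc]
  have hD0 : ((Nat.doubleFactorial (2 * n + 1) : ℕ) : ℚ) ≠ 0 := by
    exact_mod_cast (Nat.doubleFactorial_pos _).ne'
  generalize (∏ i ∈ Finset.range n, (d + 2 * n + 2 + 2 * i)) = P at *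
  generalize Nat.doubleFactorial (2 * n + 1) = D at *
  have gen : ∀ (s : ℤ) (t : ℕ), t ≠ 0 → (P : ℚ) / D = (s : ℚ) / t → p ∣ t := by
    intro s t ht he
    have ht' : (t : ℚ) ≠ 0 := by exact_mod_cast ht
    rw [div_eq_div_iff hD0 ht'] at he
    have he' : (P : ℤ) * t = s * D := by exact_mod_cast he
    have h3 : (p : ℤ) ∣ (P : ℤ) * t := by
      rw [he']
      exact (Int.natCast_dvd_natCast.2 hD).mul_left _
    have h4 : p ∣ P * t := by exact_mod_cast h3
    exact (hp.dvd_mul.1 h4).resolve_left hP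
  refine ⟨⟨p, hp, by omega, gen _ _ (Rat.den_nz _) (Rat.num_div_den _).symm⟩, ?_⟩
  rintro ⟨s, l, he⟩
  have h5 := gen s (3 ^ l) (by positivity) (by rw [he]; push_cast; rfl)
  have h6 := Nat.le_of_dvd (by norm_num) (hp.dvd_of_dvd_pow h5)
  omega
end

section
/- For n > ℓ ≥ 1, the product of ℓ consecutive integers n(n+1)···(n+ℓ-1) contains a prime divisor greater than 3ℓ/2, with the only exceptions 3·4, 8·9, and 6·7·8·9·10. -/
open Finset in
theorem hs_choose_bounds (m k : ℕ) (hk : 1 ≤ k)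
    (H : ∀ p : ℕ, p.Prime → (p ∣ ∏ i ∈ Finset.range k, (m + 1 + i)) → 2 * p ≤ 3 * k) :
    (m + k).choose k ≤ (m + k) ^ Nat.primeCounting (3 * k / 2) ∧
    (m + k).choose k ≤ (m + k) ^ Nat.primeCounting (Nat.sqrt (m + k)) * 4 ^ (3 * k / 2) := by
  set N := m + k with hN
  set C := N.choose k with hC
  have hC0 : C ≠ 0 := Nat.choose_ne_zero (by omega)
  have hdvd : C ∣ ∏ i ∈ Finset.range k, (m + 1 + i) := by
    rw [← Nat.ascFactorial_eq_prod_range, Nat.ascFactorial_eq_factorial_mul_choose]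
    exact Dvd.intro_left _ rfl
  have hsub : C.primeFactors ⊆ Nat.primesLE (3 * k / 2) := by
    intro p hp
    have hpp := Nat.prime_of_mem_primeFactors hp
    have := H p hpp ((Nat.dvd_of_mem_primeFactors hp).trans hdvd)
    rw [Nat.mem_primesLE]
    exact ⟨by omega, hpp⟩
  have hprod : C = ∏ p ∈ C.primeFactors, p ^ C.factorization p := by
    conv_lhs => rw [← Nat.prod_factorization_pow_eq_self hC0]
    rw [Nat.prod_factorization_eq_prod_primeFactors]
  have hle : ∀ p, p ^ C.factorization p ≤ N := fun p =>
    Nat.pow_factorization_choose_le (by omega)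
  have hN1 : 1 ≤ N := by omega
  constructor
  · calc C = ∏ p ∈ C.primeFactors, p ^ C.factorization p := hprod
      _ ≤ ∏ p ∈ C.primeFactors, N := Finset.prod_le_prod' fun p _ => hle p
      _ = N ^ #C.primeFactors := by simp
      _ ≤ N ^ #(Nat.primesLE (3 * k / 2)) := Nat.pow_le_pow_right hN1 (card_le_card hsub)
      _ = _ := by rw [Nat.primesLE_card_eq_primeCounting]
  · calc C = ∏ p ∈ C.primeFactors, p ^ C.factorization p := hprod
      _ = (∏ p ∈ C.primeFactors with p ≤ N.sqrt, p ^ C.factorization p) *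
          ∏ p ∈ C.primeFactors with ¬ p ≤ N.sqrt, p ^ C.factorization p :=
          (prod_filter_mul_prod_filter_not _ _ _).symm
      _ ≤ N ^ Nat.primeCounting (Nat.sqrt N) * primorial (3 * k / 2) := by
        apply Nat.mul_le_mul
        · calc _ ≤ ∏ p ∈ C.primeFactors with p ≤ N.sqrt, N := Finset.prod_le_prod' fun p _ => hle p
            _ = N ^ #{p ∈ C.primeFactors | p ≤ N.sqrt} := by simp
            _ ≤ N ^ #(Nat.primesLE N.sqrt) := by
              refine Nat.pow_le_pow_right hN1 (card_le_card ?_)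
              intro p hp
              rw [mem_filter] at hp
              exact Nat.mem_primesLE.2 ⟨hp.2, Nat.prime_of_mem_primeFactors hp.1⟩
            _ = _ := by rw [Nat.primesLE_card_eq_primeCounting]
        · calc _ ≤ ∏ p ∈ C.primeFactors with ¬ p ≤ N.sqrt, p := by
                refine Finset.prod_le_prod' fun p hp => ?_
                rw [mem_filter] at hp
                have : C.factorization p ≤ 1 := by
                  apply Nat.factorization_choose_le_one
                  have := Nat.sqrt_lt'.1 (not_le.1 hp.2)
                  exact this
                calc p ^ C.factorization p ≤ p ^ 1 := Nat.pow_le_pow_right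
                      (Nat.prime_of_mem_primeFactors hp.1).pos this
                  _ = p := pow_one p
            _ ≤ ∏ p ∈ Nat.primesLE (3 * k / 2), p := by
                refine Finset.prod_le_prod_of_subset_of_one_le' ?_ ?_
                · exact (filter_subset _ _).trans hsub
                · intro p hp _
                  exact (Nat.prime_of_mem_primesLE hp).one_le
            _ = primorial (3 * k / 2) := by
                rw [primorial, Nat.primesLE_eq_filter_range]
      _ ≤ _ := Nat.mul_le_mul_left _ (primorial_le_four_pow _)

theorem hs_pow_le (m k : ℕ) :
    (m + 1) ^ k ≤ k.factorial * (m + k).choose k := by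
  rw [← Nat.ascFactorial_eq_factorial_mul_choose]
  exact Nat.pow_succ_le_ascFactorial (m + 1) k

theorem hs_log_factorial (n N : ℕ) (h : n ≤ N) :
    Real.log (n.factorial) =
      ∑ d ∈ Finset.Ioc 0 N, ArithmeticFunction.vonMangoldt d * ((n / d : ℕ) : ℝ) := by
  have h1 : ∑ d ∈ Finset.Ioc 0 N, ArithmeticFunction.vonMangoldt d * ((n / d : ℕ) : ℝ) =
      ∑ d ∈ Finset.Ioc 0 n, ArithmeticFunction.vonMangoldt d * ((n / d : ℕ) : ℝ) := by
    symm
    apply Finset.sum_subset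
    · exact Finset.Ioc_subset_Ioc_right h
    · intro d hd hd2
      simp only [Finset.mem_Ioc] at hd hd2
      have : n / d = 0 := Nat.div_eq_of_lt (by omega)
      simp [this]
  rw [h1, ← ArithmeticFunction.sum_Ioc_mul_zeta_eq_sum, ArithmeticFunction.vonMangoldt_mul_zeta]
  clear h1 h
  induction n with
  | zero => simp
  | succ n ih =>
    rw [Finset.sum_Ioc_succ_top (Nat.zero_le _), ← ih, Nat.factorial_succ, Nat.cast_mul,
      Real.log_mul (by positivity) (by positivity)]
    simp [ArithmeticFunction.log_apply, add_comm]

noncomputable def hsU (n : ℕ) : ℝ :=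
  Real.log (n.factorial) - Real.log ((n / 2).factorial) - Real.log ((n / 3).factorial)
    - Real.log ((n / 5).factorial) + Real.log ((n / 30).factorial)

theorem hs_U_eq (n : ℕ) : hsU n = ∑ d ∈ Finset.Ioc 0 n, ArithmeticFunction.vonMangoldt d *
    (((n / d : ℕ) : ℝ) - ((n / d / 2 : ℕ) : ℝ) - ((n / d / 3 : ℕ) : ℝ) - ((n / d / 5 : ℕ) : ℝ)
      + ((n / d / 30 : ℕ) : ℝ)) := by
  have e : ∀ j d : ℕ, n / d / j = n / j / d := fun j d => by
    rw [Nat.div_div_eq_div_mul, Nat.div_div_eq_div_mul, mul_comm]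
  rw [hsU, hs_log_factorial n n le_rfl, hs_log_factorial (n / 2) n (Nat.div_le_self _ _),
    hs_log_factorial (n / 3) n (Nat.div_le_self _ _),
    hs_log_factorial (n / 5) n (Nat.div_le_self _ _),
    hs_log_factorial (n / 30) n (Nat.div_le_self _ _), ← Finset.sum_sub_distrib,
    ← Finset.sum_sub_distrib, ← Finset.sum_sub_distrib, ← Finset.sum_add_distrib]
  refine Finset.sum_congr rfl fun d _ => ?_
  rw [e 2 d, e 3 d, e 5 d, e 30 d]
  ring

theorem hs_coef (q : ℕ) :
    ((q : ℕ) : ℝ) - ((q / 2 : ℕ) : ℝ) - ((q / 3 : ℕ) : ℝ) - ((q / 5 : ℕ) : ℝ)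
      + ((q / 30 : ℕ) : ℝ) ≤ 1 ∧
    0 ≤ ((q : ℕ) : ℝ) - ((q / 2 : ℕ) : ℝ) - ((q / 3 : ℕ) : ℝ) - ((q / 5 : ℕ) : ℝ)
      + ((q / 30 : ℕ) : ℝ) ∧
    (1 ≤ q → q < 6 → ((q : ℕ) : ℝ) - ((q / 2 : ℕ) : ℝ) - ((q / 3 : ℕ) : ℝ) - ((q / 5 : ℕ) : ℝ)
      + ((q / 30 : ℕ) : ℝ) = 1) := by
  have a1 : q + q / 30 ≤ 1 + q / 2 + q / 3 + q / 5 := by omega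
  have a2 : q / 2 + q / 3 + q / 5 ≤ q + q / 30 := by omega
  have b1 : ((q + q / 30 : ℕ) : ℝ) ≤ ((1 + q / 2 + q / 3 + q / 5 : ℕ) : ℝ) := by exact_mod_cast a1
  have b2 : ((q / 2 + q / 3 + q / 5 : ℕ) : ℝ) ≤ ((q + q / 30 : ℕ) : ℝ) := by exact_mod_cast a2
  push_cast at b1 b2
  refine ⟨by linarith, by linarith, fun h1 h6 => ?_⟩
  interval_cases q <;> norm_num

theorem hs_psi_bounds (n : ℕ) :
    hsU n ≤ Chebyshev.psi n ∧ Chebyshev.psi n - Chebyshev.psi ((n / 6 : ℕ) : ℝ) ≤ hsU n := by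
  have hp : Chebyshev.psi n = ∑ d ∈ Finset.Ioc 0 n, ArithmeticFunction.vonMangoldt d := by
    simp [Chebyshev.psi]
  have hp6 : Chebyshev.psi ((n / 6 : ℕ) : ℝ) =
      ∑ d ∈ Finset.Ioc 0 (n / 6), ArithmeticFunction.vonMangoldt d := by
    simp only [Chebyshev.psi, Nat.floor_natCast]
  constructor
  · rw [hs_U_eq, hp]
    refine Finset.sum_le_sum fun d _ => ?_
    have := (hs_coef (n / d)).1
    have h0 := ArithmeticFunction.vonMangoldt_nonneg (n := d)
    nlinarith
  · rw [hs_U_eq, hp, hp6]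
    have hsplit : ∑ d ∈ Finset.Ioc 0 n, ArithmeticFunction.vonMangoldt d =
        ∑ d ∈ Finset.Ioc 0 (n / 6), ArithmeticFunction.vonMangoldt d +
        ∑ d ∈ Finset.Ioc (n / 6) n, ArithmeticFunction.vonMangoldt d :=
      (Finset.sum_Ioc_consecutive _ (Nat.zero_le _) (Nat.div_le_self _ _)).symm
    rw [hsplit, add_sub_cancel_left]
    refine le_trans ?_ (Finset.sum_le_sum_of_subset_of_nonneg
      (Finset.Ioc_subset_Ioc_left (Nat.zero_le (n / 6))) ?_)
    · refine Finset.sum_le_sum fun d hd => ?_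
      rw [Finset.mem_Ioc] at hd
      have hd0 : 0 < d := by omega
      rw [(hs_coef (n / d)).2.2 ?_ ?_, mul_one]
      · rw [Nat.one_le_div_iff hd0]; exact hd.2
      · rw [Nat.div_lt_iff_lt_mul hd0]; omega
    · intro d _ _
      exact mul_nonneg ArithmeticFunction.vonMangoldt_nonneg (hs_coef _).2.1

theorem hs_stirling_upper (n : ℕ) (hn : 1 ≤ n) :
    Real.log n.factorial ≤ n * Real.log n - n + Real.log n / 2 + 1 := by
  have h := Stirling.stirlingSeq'_antitone (Nat.zero_le (n - 1))
  simp only [Function.comp] at h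
  rw [show (n - 1).succ = n by omega, Nat.succ_eq_add_one, zero_add, Stirling.stirlingSeq_one,
    Stirling.stirlingSeq] at h
  have hn0 : (0 : ℝ) < n := by exact_mod_cast hn
  have hpos : 0 < √(2 * (n : ℝ)) * ((n : ℝ) / Real.exp 1) ^ n := by positivity
  rw [div_le_iff₀ hpos] at h
  have h2 := Real.log_le_log (by positivity) h
  rw [Real.log_mul (by positivity) (by positivity), Real.log_mul (by positivity) (by positivity),
    Real.log_div (by positivity) (by positivity), Real.log_pow, Real.log_div (by positivity)
    (by positivity), Real.log_exp, Real.log_sqrt (by positivity), Real.log_sqrt (by positivity),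
    Real.log_mul (by positivity) (by positivity)] at h2
  linarith

theorem hs_stirling_lower (n : ℕ) :
    n * Real.log n - n ≤ Real.log n.factorial := by
  rcases Nat.eq_zero_or_pos n with rfl | hn
  · simp
  have := Stirling.le_log_factorial_stirling hn.ne'
  have h1 : 0 ≤ Real.log (n : ℝ) := Real.log_natCast_nonneg n
  have h2 : 0 ≤ Real.log (2 * Real.pi) := Real.log_nonneg (by linarith [Real.pi_gt_three])
  linarith

theorem hs_mono {x y : ℝ} (hx : 1 ≤ x) (hxy : x ≤ y) :
    x * Real.log x - x ≤ y * Real.log y - y := by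
  have hx0 : 0 < x := by linarith
  have hy0 : 0 < y := by linarith
  have h1 := Real.log_le_sub_one_of_pos (div_pos hx0 hy0)
  rw [Real.log_div hx0.ne' hy0.ne'] at h1
  have h2 : 0 ≤ Real.log x := Real.log_nonneg hx
  have h3 : y * (Real.log x - Real.log y) ≤ y * (x / y - 1) := mul_le_mul_of_nonneg_left h1 hy0.le
  have h4 : y * (x / y - 1) = x - y := by field_simp
  nlinarith

theorem hs_T_bounds (n j : ℕ) (hj : 2 ≤ j) (hn : j ≤ n) :
    Real.log ((n / j).factorial) ≤ (n / j : ℝ) * Real.log (n / j : ℝ) - (n / j : ℝ)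
      + Real.log n / 2 + 1 ∧
    (n / j : ℝ) * Real.log (n / j : ℝ) - (n / j : ℝ) - Real.log n ≤
      Real.log ((n / j).factorial) := by
  have hj0 : (0 : ℝ) < j := by exact_mod_cast (by omega : 0 < j)
  have hn0 : (0 : ℝ) < n := by exact_mod_cast (by omega : 0 < n)
  set m := n / j with hm
  have hm1 : 1 ≤ m := by rw [hm, Nat.one_le_div_iff (by omega)]; exact hn
  have hm0 : (0 : ℝ) < m := by exact_mod_cast hm1
  have hmy : (m : ℝ) ≤ (n / j : ℝ) := Nat.cast_div_le
  have hym : (n / j : ℝ) ≤ (m + 1 : ℕ) := by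
    rw [div_le_iff₀ hj0]
    have : n < (m + 1) * j := by
      rw [hm, mul_comm]; exact Nat.lt_mul_div_succ n (by omega)
    exact_mod_cast this.le
  have hy1 : (1 : ℝ) ≤ n / j := le_trans (by exact_mod_cast hm1) hmy
  have hmn : m + 1 ≤ n := by
    have : m * 2 ≤ n := le_trans (Nat.mul_le_mul_left m hj) (Nat.div_mul_le_self n j)
    omega
  constructor
  · have h1 := hs_stirling_upper m hm1
    have h2 := hs_mono (by exact_mod_cast hm1) hmy
    have h3 : Real.log m ≤ Real.log n := Real.log_le_log hm0 (by exact_mod_cast (by omega : m ≤ n))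
    linarith
  · have h1 := hs_stirling_lower (m + 1)
    have h2 := hs_mono hy1 hym
    rw [Nat.factorial_succ, Nat.cast_mul, Real.log_mul (by positivity) (by positivity)] at h1
    have h3 : Real.log ((m + 1 : ℕ) : ℝ) ≤ Real.log n :=
      Real.log_le_log (by positivity) (by exact_mod_cast hmn)
    linarith

theorem hs_A : 
    (0.9211 : ℝ) ≤ 14 / 30 * Real.log 2 + 9 / 30 * Real.log 3 + 5 / 30 * Real.log 5 ∧
    14 / 30 * Real.log 2 + 9 / 30 * Real.log 3 + 5 / 30 * Real.log 5 ≤ (0.9215 : ℝ) := by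
  have e : 14 * Real.log 2 + 9 * Real.log 3 + 5 * Real.log 5 =
      40 * Real.log 2 + Real.log (2 ^ 14 * 3 ^ 9 * 5 ^ 5 / 2 ^ 40) := by
    rw [Real.log_div (by positivity) (by positivity), Real.log_mul (by positivity) (by positivity),
      Real.log_mul (by positivity) (by positivity), Real.log_pow, Real.log_pow, Real.log_pow,
      Real.log_pow]
    push_cast; ring
  have u := Real.log_le_sub_one_of_pos (x := 2 ^ 14 * 3 ^ 9 * 5 ^ 5 / 2 ^ 40) (by positivity)
  have l := Real.one_sub_inv_le_log_of_pos (x := 2 ^ 14 * 3 ^ 9 * 5 ^ 5 / 2 ^ 40) (by positivity)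
  have l2 := Real.log_two_gt_d9
  have u2 := Real.log_two_lt_d9
  norm_num at u l e ⊢
  constructor <;> linarith

theorem hs_U_bounds (n : ℕ) (hn : 30 ≤ n) :
    hsU n ≤ 0.9215 * n + 4 * Real.log n + 2 ∧ 0.9211 * n - 3 * Real.log n - 3 ≤ hsU n := by
  have hn0 : (0 : ℝ) < n := by exact_mod_cast (by omega : 0 < n)
  have hL : 0 ≤ Real.log (n : ℝ) := Real.log_natCast_nonneg n
  have b2 := hs_T_bounds n 2 (by norm_num) (by omega)
  have b3 := hs_T_bounds n 3 (by norm_num) (by omega)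
  have b5 := hs_T_bounds n 5 (by norm_num) (by omega)
  have b30 := hs_T_bounds n 30 (by norm_num) (by omega)
  have bu := hs_stirling_upper n (by omega)
  have bl := hs_stirling_lower n
  have e30 : Real.log 30 = Real.log 2 + Real.log 3 + Real.log 5 := by
    rw [← Real.log_mul (by norm_num) (by norm_num), ← Real.log_mul (by norm_num) (by norm_num)]
    norm_num
  push_cast at b2 b3 b5 b30
  rw [Real.log_div hn0.ne' (by norm_num)] at b2 b3 b5 b30
  rw [e30] at b30
  have A := hs_A
  have A1 := mul_le_mul_of_nonneg_right A.1 hn0.le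
  have A2 := mul_le_mul_of_nonneg_right A.2 hn0.le
  unfold hsU
  obtain ⟨b2u, b2l⟩ := b2
  obtain ⟨b3u, b3l⟩ := b3
  obtain ⟨b5u, b5l⟩ := b5
  obtain ⟨b30u, b30l⟩ := b30
  constructor
  · nlinarith
  · nlinarith

theorem hs_psi_upper (n : ℕ) : Chebyshev.psi n ≤ 1.12 * n + 7000 := by
  induction n using Nat.strong_induction_on with
  | _ n ih =>
    rcases lt_or_ge n 4096 with h | h
    · rcases Nat.eq_zero_or_pos n with rfl | hn
      · simp
      have hn1 : (1 : ℝ) ≤ n := by exact_mod_cast hn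
      have h1 := Chebyshev.psi_le hn1
      have hn2 : (n : ℝ) ≤ 4096 := by exact_mod_cast h.le
      have hs : √(n : ℝ) ≤ 64 := by
        rw [Real.sqrt_le_left (by norm_num)]; linarith
      have e4 : Real.log 4 = 2 * Real.log 2 := by
        rw [show (4 : ℝ) = 2 ^ 2 by norm_num, Real.log_pow]; norm_num
      have e12 : Real.log 4096 = 12 * Real.log 2 := by
        rw [show (4096 : ℝ) = 2 ^ 12 by norm_num, Real.log_pow]; norm_num
      have hl : Real.log n ≤ 12 * Real.log 2 := by
        rw [← e12]; exact Real.log_le_log (by linarith) hn2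
      have l0 : 0 ≤ Real.log (n : ℝ) := Real.log_natCast_nonneg n
      have u2 := Real.log_two_lt_d9
      have l2 := Real.log_two_gt_d9
      have hm : √(n : ℝ) * Real.log n ≤ 64 * (12 * 0.7) := by
        apply mul_le_mul hs (by linarith) l0 (by norm_num)
      rw [e4] at h1
      nlinarith
    · have h1 := (hs_psi_bounds n).2
      have h2 := (hs_U_bounds n (by omega)).1
      have h3 := ih (n / 6) (by omega)
      have h4 : ((n / 6 : ℕ) : ℝ) ≤ (n : ℝ) / 6 := by
        have := @Nat.cast_div_le ℝ _ _ _ n 6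
        exact_mod_cast this
      have hn : (4096 : ℝ) ≤ n := by exact_mod_cast h
      have e12 : Real.log 4096 = 12 * Real.log 2 := by
        rw [show (4096 : ℝ) = 2 ^ 12 by norm_num, Real.log_pow]; norm_num
      have h5 := Real.log_le_sub_one_of_pos (x := (n : ℝ) / 4096) (by linarith)
      rw [Real.log_div (by linarith) (by norm_num), e12] at h5
      have u2 := Real.log_two_lt_d9
      linarith

theorem hs_prime_large (x : ℕ) (hx : 4000000 ≤ x) : ∃ p : ℕ, p.Prime ∧ x < p ∧ 4 * p ≤ 5 * x := by
  by_contra hcon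
  push Not at hcon
  set M := 5 * x / 4 with hM
  have hxM : x ≤ M := by omega
  have hMx : 5 * x < 4 * (M + 1) := by omega
  have hth : Chebyshev.theta M = Chebyshev.theta x := by
    rw [Chebyshev.theta_eq_sum_primesLE_log, Chebyshev.theta_eq_sum_primesLE_log]
    congr 1
    ext p
    rw [Nat.mem_primesLE, Nat.mem_primesLE]
    constructor
    · rintro ⟨h1, h2⟩
      refine ⟨?_, h2⟩
      by_contra h3
      have := hcon p h2 (by omega)
      omega
    · rintro ⟨h1, h2⟩
      exact ⟨by omega, h2⟩
  have hMbig : 2 ^ 22 ≤ M := by omega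
  have hM1 : (1 : ℝ) ≤ M := by exact_mod_cast (by omega : 1 ≤ M)
  have h1 := Chebyshev.psi_sub_theta_le hM1
  have h2 := (hs_psi_bounds M).1
  have h3 := (hs_U_bounds M (by omega)).2
  have h4 := hs_psi_upper x
  have h5 := Chebyshev.theta_le_psi x
  have h6 : 5 * (x : ℝ) ≤ 4 * (M + 1) := by exact_mod_cast hMx.le
  set s := √(M : ℝ) with hs
  have hs2 : s ^ 2 = M := Real.sq_sqrt (by linarith)
  have hs0 : (2048 : ℝ) ≤ s := by
    rw [hs]
    apply Real.le_sqrt_of_sq_le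
    have : ((2 ^ 22 : ℕ) : ℝ) ≤ M := by exact_mod_cast hMbig
    norm_num at this ⊢
    linarith
  have h7 : Real.log M = 2 * Real.log s := by
    rw [← hs2, Real.log_pow]; norm_num
  have e11 : Real.log 2048 = 11 * Real.log 2 := by
    rw [show (2048 : ℝ) = 2 ^ 11 by norm_num, Real.log_pow]; norm_num
  have h8 := Real.log_le_sub_one_of_pos (x := s / 2048) (by linarith)
  rw [Real.log_div (by linarith) (by norm_num), e11] at h8
  have u2 := Real.log_two_lt_d9
  have h9 : Real.log s ≤ 6.625 + s / 2048 := by linarith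
  rw [h7] at h1 h3
  rw [hth] at h1
  have h10 : s * Real.log s ≤ s * (6.625 + s / 2048) :=
    mul_le_mul_of_nonneg_left h9 (by linarith)
  rw [← hs2] at h3 h6
  nlinarith

theorem hs_prime_between (x : ℕ) (hx : 24 ≤ x) : ∃ p : ℕ, p.Prime ∧ x < p ∧ 4 * p ≤ 5 * x := by
  by_contra hcon
  have hlt : x < 4000000 := by
    by_contra h
    exact hcon (hs_prime_large x (by omega))
  have key : ∀ a p : ℕ, p.Prime → 4 * p ≤ 5 * a → a ≤ x → p ≤ x := by
    intro a p hp h1 h2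
    by_contra h3
    exact hcon ⟨p, hp, by omega, by omega⟩
  have h1 := key 24 29 (by norm_num) (by norm_num) hx
  have h2 := key 29 31 (by norm_num) (by norm_num) h1
  have h3 := key 31 37 (by norm_num) (by norm_num) h2
  have h4 := key 37 43 (by norm_num) (by norm_num) h3
  have h5 := key 43 53 (by norm_num) (by norm_num) h4
  have h6 := key 53 61 (by norm_num) (by norm_num) h5
  have h7 := key 61 73 (by norm_num) (by norm_num) h6
  have h8 := key 73 89 (by norm_num) (by norm_num) h7
  have h9 := key 89 109 (by norm_num) (by norm_num) h8
  have h10 := key 109 131 (by norm_num) (by norm_num) h9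
  have h11 := key 131 163 (by norm_num) (by norm_num) h10
  have h12 := key 163 199 (by norm_num) (by norm_num) h11
  have h13 := key 199 241 (by norm_num) (by norm_num) h12
  have h14 := key 241 293 (by norm_num) (by norm_num) h13
  have h15 := key 293 359 (by norm_num) (by norm_num) h14
  have h16 := key 359 443 (by norm_num) (by norm_num) h15
  have h17 := key 443 547 (by norm_num) (by norm_num) h16
  have h18 := key 547 683 (by norm_num) (by norm_num) h17
  have h19 := key 683 853 (by norm_num) (by norm_num) h18
  have h20 := key 853 1063 (by norm_num) (by norm_num) h19
  have h21 := key 1063 1327 (by norm_num) (by norm_num) h20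
  have h22 := key 1327 1657 (by norm_num) (by norm_num) h21
  have h23 := key 1657 2069 (by norm_num) (by norm_num) h22
  have h24 := key 2069 2579 (by norm_num) (by norm_num) h23
  have h25 := key 2579 3221 (by norm_num) (by norm_num) h24
  have h26 := key 3221 4021 (by norm_num) (by norm_num) h25
  have h27 := key 4021 5023 (by norm_num) (by norm_num) h26
  have h28 := key 5023 6277 (by norm_num) (by norm_num) h27
  have h29 := key 6277 7841 (by norm_num) (by norm_num) h28
  have h30 := key 7841 9791 (by norm_num) (by norm_num) h29
  have h31 := key 9791 12227 (by norm_num) (by norm_num) h30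
  have h32 := key 12227 15277 (by norm_num) (by norm_num) h31
  have h33 := key 15277 19087 (by norm_num) (by norm_num) h32
  have h34 := key 19087 23857 (by norm_num) (by norm_num) h33
  have h35 := key 23857 29819 (by norm_num) (by norm_num) h34
  have h36 := key 29819 37273 (by norm_num) (by norm_num) h35
  have h37 := key 37273 46591 (by norm_num) (by norm_num) h36
  have h38 := key 46591 58237 (by norm_num) (by norm_num) h37
  have h39 := key 58237 72767 (by norm_num) (by norm_num) h38
  have h40 := key 72767 90947 (by norm_num) (by norm_num) h39
  have h41 := key 90947 113683 (by norm_num) (by norm_num) h40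
  have h42 := key 113683 142099 (by norm_num) (by norm_num) h41
  have h43 := key 142099 177623 (by norm_num) (by norm_num) h42
  have h44 := key 177623 222023 (by norm_num) (by norm_num) h43
  have h45 := key 222023 277513 (by norm_num) (by norm_num) h44
  have h46 := key 277513 346891 (by norm_num) (by norm_num) h45
  have h47 := key 346891 433607 (by norm_num) (by norm_num) h46
  have h48 := key 433607 541999 (by norm_num) (by norm_num) h47
  have h49 := key 541999 677473 (by norm_num) (by norm_num) h48
  have h50 := key 677473 846841 (by norm_num) (by norm_num) h49
  have h51 := key 846841 1058549 (by norm_num) (by norm_num) h50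
  have h52 := key 1058549 1323169 (by norm_num) (by norm_num) h51
  have h53 := key 1323169 1653959 (by norm_num) (by norm_num) h52
  have h54 := key 1653959 2067437 (by norm_num) (by norm_num) h53
  have h55 := key 2067437 2584291 (by norm_num) (by norm_num) h54
  have h56 := key 2584291 3230363 (by norm_num) (by norm_num) h55
  have h57 := key 3230363 4037953 (by norm_num) (by norm_num) h56
  omega

theorem hs_pi_third (y : ℕ) : (Nat.primeCounting y : ℝ) ≤ y / 3 + 3 := by
  have h : 3 * Nat.primeCounting y ≤ y + 9 := by
    rcases lt_or_ge y 6 with h | h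
    · interval_cases y <;> decide
    · have h1 := Nat.primeCounting_add_le (a := 6) (k := 6) (by norm_num) le_rfl (y - 6)
      rw [show 6 + (y - 6) = y by omega, show Nat.primeCounting 6 = 3 by decide,
        show Nat.totient 6 = 2 by decide] at h1
      omega
  have h2 : (3 : ℝ) * Nat.primeCounting y ≤ y + 9 := by exact_mod_cast h
  linarith

theorem hs_pi_lin (k : ℕ) (hk : 30 ≤ k) :
    (Nat.primeCounting (3 * k / 2) : ℝ) ≤ 2 / 5 * k + 10 := by
  have h : 5 * Nat.primeCounting (3 * k / 2) ≤ 2 * k + 50 := by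
    have h1 := Nat.primeCounting_add_le (a := 30) (k := 30) (by norm_num) le_rfl (3 * k / 2 - 30)
    rw [show 30 + (3 * k / 2 - 30) = 3 * k / 2 by omega, show Nat.primeCounting 30 = 10 by decide,
        show Nat.totient 30 = 8 by decide] at h1
    omega
  have h2 : (5 : ℝ) * Nat.primeCounting (3 * k / 2) ≤ 2 * k + 50 := by exact_mod_cast h
  linarith

set_option maxHeartbeats 1000000 in
theorem hs_case_large (m k : ℕ) (hk : 4096 ≤ k) (hm : 4 * k ≤ m + 1)
    (H : ∀ p : ℕ, p.Prime → (p ∣ ∏ i ∈ Finset.range k, (m + 1 + i)) → 2 * p ≤ 3 * k) :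
    False := by
  obtain ⟨c1, c2⟩ := hs_choose_bounds m k (by omega) H
  have c3 := hs_pow_le m k
  have hkR : (4096 : ℝ) ≤ k := by exact_mod_cast hk
  have hk0 : (0 : ℝ) < k := by linarith
  obtain ⟨n, hn⟩ : ∃ n : ℝ, n = m + 1 := ⟨_, rfl⟩
  obtain ⟨N, hN⟩ : ∃ N : ℝ, N = m + k := ⟨_, rfl⟩
  have hn4 : 4 * (k : ℝ) ≤ n := by rw [hn]; exact_mod_cast hm
  have hNn : N ≤ n + k := by rw [hN, hn]; linarith
  have hn0 : 0 < n := by linarith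
  have hN0 : 0 < N := by rw [hN]; positivity
  have hnN : n ≤ N := by rw [hN, hn]; linarith
  have hC0 : (0 : ℝ) < ((m + k).choose k : ℕ) := by
    exact_mod_cast Nat.choose_pos (by omega)
  -- the log form of the lower bound
  have d3 : (k : ℝ) * Real.log n ≤ k * Real.log k - k + Real.log k / 2 + 1
      + Real.log ((m + k).choose k : ℕ) := by
    have h : n ^ k ≤ (k.factorial : ℝ) * ((m + k).choose k : ℕ) := by
      rw [hn]; exact_mod_cast c3
    have h2 := Real.log_le_log (by positivity) h
    rw [Real.log_pow, Real.log_mul (by positivity) hC0.ne'] at h2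
    have := hs_stirling_upper k (by omega)
    linarith
  have d1 : Real.log ((m + k).choose k : ℕ) ≤
      Nat.primeCounting (3 * k / 2) * Real.log N := by
    have h : (((m + k).choose k : ℕ) : ℝ) ≤ N ^ Nat.primeCounting (3 * k / 2) := by
      rw [hN]; exact_mod_cast c1
    have h2 := Real.log_le_log hC0 h
    rwa [Real.log_pow] at h2
  have hlogN0 : 0 ≤ Real.log N := Real.log_nonneg (by linarith)
  have d2 : Real.log ((m + k).choose k : ℕ) ≤
      (√N / 3 + 3) * Real.log N + 3 * k * Real.log 2 := by
    have h : (((m + k).choose k : ℕ) : ℝ) ≤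
        N ^ Nat.primeCounting (Nat.sqrt (m + k)) * 4 ^ (3 * k / 2) := by
      rw [hN]; exact_mod_cast c2
    have h2 := Real.log_le_log hC0 h
    rw [Real.log_mul (by positivity) (by positivity), Real.log_pow, Real.log_pow,
      show (4 : ℝ) = 2 ^ 2 by norm_num, Real.log_pow] at h2
    have h3 := hs_pi_third (Nat.sqrt (m + k))
    have h4 : (Nat.sqrt (m + k) : ℝ) ≤ √N := by
      rw [hN]
      have := Real.nat_sqrt_le_real_sqrt (a := m + k)
      exact_mod_cast this
    have h5 : (Nat.primeCounting (Nat.sqrt (m + k)) : ℝ) * Real.log N ≤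
        (√N / 3 + 3) * Real.log N := mul_le_mul_of_nonneg_right (by linarith) hlogN0
    have h6 : ((3 * k / 2 : ℕ) : ℝ) ≤ 3 * k / 2 := by
      have := @Nat.cast_div_le ℝ _ _ _ (3 * k) 2
      exact_mod_cast this
    have l2 : 0 ≤ Real.log 2 := Real.log_nonneg (by norm_num)
    push_cast at h2
    nlinarith
  have l2 := Real.log_two_gt_d9
  have u2 := Real.log_two_lt_d9
  have e12 : Real.log 4096 = 12 * Real.log 2 := by
    rw [show (4096 : ℝ) = 2 ^ 12 by norm_num, Real.log_pow]; norm_num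
  have hlogk : Real.log k ≤ 7.32 + k / 4096 := by
    have h5 := Real.log_le_sub_one_of_pos (x := (k : ℝ) / 4096) (by linarith)
    rw [Real.log_div (by linarith) (by norm_num), e12] at h5
    linarith
  have hlogk0 : 0 ≤ Real.log (k : ℝ) := Real.log_natCast_nonneg k
  by_cases hbig : (k : ℝ) ^ 5 ≤ n ^ 3
  · -- very large n
    have b1 : 5 * Real.log k ≤ 3 * Real.log n := by
      have := Real.log_le_log (by positivity) hbig
      rw [Real.log_pow, Real.log_pow] at this
      exact_mod_cast this
    have b2 : Real.log N ≤ Real.log n + 0.25 := by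
      have h5 := Real.log_le_sub_one_of_pos (x := N / n) (by positivity)
      rw [Real.log_div hN0.ne' hn0.ne'] at h5
      have : N / n ≤ 1.25 := by rw [div_le_iff₀ hn0]; linarith
      linarith
    have hP := hs_pi_lin k (by omega)
    obtain ⟨P, hPd⟩ : ∃ P : ℝ, P = Nat.primeCounting (3 * k / 2) := ⟨_, rfl⟩
    rw [← hPd] at hP d1
    have hP0 : 0 ≤ P := by rw [hPd]; positivity
    have f1 : P * Real.log N ≤ P * (Real.log n + 0.25) := mul_le_mul_of_nonneg_left b2 hP0
    have f2 : (3 / 5 * k - 10) * (5 / 3 * Real.log k) ≤ (k - P) * Real.log n := by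
      apply mul_le_mul (by linarith) (by linarith) (by linarith) (by linarith)
    linarith
  · push Not at hbig
    have hkpos := hk0
    by_cases h16 : n < 16 * k
    · have b1 : Real.log k + 2 * Real.log 2 ≤ Real.log n := by
        have := Real.log_le_log (by positivity) hn4
        rw [Real.log_mul (by norm_num) (by positivity), show (4 : ℝ) = 2 ^ 2 by norm_num,
          Real.log_pow] at this
        push_cast at this
        linarith
      obtain ⟨s, hs⟩ : ∃ s : ℝ, s = √(k : ℝ) := ⟨_, rfl⟩
      have hs2 : s ^ 2 = k := by rw [hs]; exact Real.sq_sqrt hk0.le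
      have hs64 : 64 ≤ s := by
        rw [hs]; apply Real.le_sqrt_of_sq_le; linarith
      have hN17 : N ≤ 17 * k := by linarith
      have hsN : √N ≤ 4.124 * s := by
        rw [Real.sqrt_le_left (by linarith)]
        nlinarith
      have hls : Real.log s ≤ 3.16 + s / 64 := by
        have h5 := Real.log_le_sub_one_of_pos (x := s / 64) (by linarith)
        rw [Real.log_div (by linarith) (by norm_num), show (64 : ℝ) = 2 ^ 6 by norm_num,
          Real.log_pow] at h5
        push_cast at h5
        linarith
      have hlk : Real.log k = 2 * Real.log s := by rw [← hs2, Real.log_pow]; norm_num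
      have hlN : Real.log N ≤ 2.84 + 2 * (3.16 + s / 64) := by
        have h1 := Real.log_le_log hN0 hN17
        rw [Real.log_mul (by norm_num) (by positivity), hlk] at h1
        have h17 := Real.log_le_sub_one_of_pos (x := (17 : ℝ) / 16) (by norm_num)
        rw [Real.log_div (by norm_num) (by norm_num), show (16 : ℝ) = 2 ^ 4 by norm_num,
          Real.log_pow] at h17
        push_cast at h17
        linarith
      have f1 : (√N / 3 + 3) * Real.log N ≤
          (4.124 * s / 3 + 3) * (2.84 + 2 * (3.16 + s / 64)) := by
        apply mul_le_mul (by linarith) hlN hlogN0 (by linarith)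
      have f2 : (k : ℝ) * (Real.log k + 2 * Real.log 2) ≤ k * Real.log n :=
        mul_le_mul_of_nonneg_left b1 hk0.le
      have f3 : 0.306 * (k : ℝ) ≤ k * (1 - Real.log 2) := by
        rw [mul_comm]; exact mul_le_mul_of_nonneg_left (by linarith) hk0.le
      have g : 64 * s ≤ k := by rw [← hs2, sq]; exact mul_le_mul_of_nonneg_right hs64 (by linarith)
      have e : (4.124 * s / 3 + 3) * (2.84 + 2 * (3.16 + s / 64)) =
          (4.124 / 96) * s ^ 2 + (4.124 * 9.16 / 3 + 3 / 32) * s + 27.48 := by ring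
      rw [e, hs2] at f1
      linarith
    · push Not at h16
      have b1 : Real.log k + 4 * Real.log 2 ≤ Real.log n := by
        have := Real.log_le_log (by positivity) h16
        rw [Real.log_mul (by norm_num) (by positivity), show (16 : ℝ) = 2 ^ 4 by norm_num,
          Real.log_pow] at this
        push_cast at this
        linarith
      obtain ⟨q, hq⟩ : ∃ q : ℝ, q = (k : ℝ) ^ ((6 : ℕ) : ℝ)⁻¹ := ⟨_, rfl⟩
      have hq0 : 0 ≤ q := by rw [hq]; positivity
      have hq6 : q ^ 6 = k := by
        rw [hq]; exact Real.rpow_inv_natCast_pow hk0.le (by norm_num)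
      have hq4 : 4 ≤ q := by
        by_contra hlt
        push Not at hlt
        have : q ^ 6 < 4 ^ 6 := pow_lt_pow_left₀ hlt hq0 (by norm_num)
        rw [hq6] at this
        linarith
      have hnq : n < q ^ 10 := by
        by_contra hge
        push Not at hge
        have : (q ^ 10) ^ 3 ≤ n ^ 3 := pow_le_pow_left₀ (by positivity) hge 3
        rw [← hq6] at hbig
        have e : (q ^ 10) ^ 3 = (q ^ 6) ^ 5 := by ring
        linarith
      have hNq : N ≤ 1.0625 * q ^ 10 := by linarith
      have hsN : √N ≤ 1.04 * q ^ 5 := by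
        rw [Real.sqrt_le_left (by positivity)]
        have e : (1.04 * q ^ 5) ^ 2 = 1.0816 * q ^ 10 := by ring
        have : 0 ≤ q ^ 10 := by positivity
        rw [e]; linarith
      have hlq : Real.log q ≤ 0.387 + q / 4 := by
        have h5 := Real.log_le_sub_one_of_pos (x := q / 4) (by linarith)
        rw [Real.log_div (by linarith) (by norm_num), show (4 : ℝ) = 2 ^ 2 by norm_num,
          Real.log_pow] at h5
        push_cast at h5
        linarith
      have hlN : Real.log N ≤ 0.0625 + 10 * (0.387 + q / 4) := by
        have h1 := Real.log_le_log hN0 hNq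
        rw [Real.log_mul (by norm_num) (by positivity), Real.log_pow] at h1
        have h17 := Real.log_le_sub_one_of_pos (x := (1.0625 : ℝ)) (by norm_num)
        push_cast at h1
        linarith
      have f1 : (√N / 3 + 3) * Real.log N ≤
          (1.04 * q ^ 5 / 3 + 3) * (0.0625 + 10 * (0.387 + q / 4)) := by
        apply mul_le_mul (by linarith) hlN hlogN0 (by positivity)
      have f2 : (k : ℝ) * (Real.log k + 4 * Real.log 2) ≤ k * Real.log n :=
        mul_le_mul_of_nonneg_left b1 hk0.le
      have f3 : 1.69 * (k : ℝ) ≤ k * (1 + Real.log 2) := by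
        rw [mul_comm]; exact mul_le_mul_of_nonneg_left (by linarith) hk0.le
      have f4 : 1.69 * (k : ℝ) ≤ Real.log k / 2 + 1 +
          (1.04 * q ^ 5 / 3 + 3) * (0.0625 + 10 * (0.387 + q / 4)) := by linarith
      have g5 : 1024 ≤ q ^ 5 := by
        calc (1024 : ℝ) = 4 ^ 5 := by norm_num
          _ ≤ q ^ 5 := pow_le_pow_left₀ (by norm_num) hq4 5
      have g6 : 4 * q ^ 5 ≤ q ^ 6 := by
        have : q ^ 6 = q * q ^ 5 := by ring
        rw [this]; exact mul_le_mul_of_nonneg_right hq4 (by linarith)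
      have g1 : 256 * q ≤ q ^ 5 := by
        have h4 : (4 : ℝ) ^ 4 ≤ q ^ 4 := pow_le_pow_left₀ (by norm_num) hq4 4
        have : q ^ 5 = q ^ 4 * q := by ring
        rw [this]; nlinarith
      have e : (1.04 * q ^ 5 / 3 + 3) * (0.0625 + 10 * (0.387 + q / 4)) =
          (1.04 * 2.5 / 3) * q ^ 6 + (1.04 / 3 * 3.9325) * q ^ 5 + 7.5 * q + 3 * 3.9325 := by ring
      rw [e] at f4
      rw [← hq6] at f4 hlogk
      linarith

theorem hs_key (m k P : ℕ) (hk : 1 ≤ k) (hm : 4 * k ≤ m + 1)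
    (hP : Nat.primeCounting (3 * k / 2) ≤ P)
    (H : ∀ p : ℕ, p.Prime → (p ∣ ∏ i ∈ Finset.range k, (m + 1 + i)) → 2 * p ≤ 3 * k) :
    4 ^ P * (m + 1) ^ k ≤ k.factorial * (5 * (m + 1)) ^ P := by
  obtain ⟨c1, -⟩ := hs_choose_bounds m k hk H
  have c3 := hs_pow_le m k
  calc 4 ^ P * (m + 1) ^ k ≤ 4 ^ P * (k.factorial * (m + k) ^ P) := by
        gcongr
        exact c3.trans (Nat.mul_le_mul_left _ (c1.trans (Nat.pow_le_pow_right (by omega) hP)))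
    _ = k.factorial * (4 * (m + k)) ^ P := by rw [mul_pow]; ring
    _ ≤ k.factorial * (5 * (m + 1)) ^ P := by
        gcongr 2
        omega

theorem hs_key2 (m k P b : ℕ) (hk : 1 ≤ k) (hm : 4 * k ≤ m + 1) (hb : b ≤ m + 1)
    (hP : Nat.primeCounting (3 * k / 2) ≤ P) (hPk : P ≤ k)
    (hc : k.factorial * 5 ^ P < 4 ^ P * b ^ (k - P))
    (H : ∀ p : ℕ, p.Prime → (p ∣ ∏ i ∈ Finset.range k, (m + 1 + i)) → 2 * p ≤ 3 * k) :
    False := by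
  have h := hs_key m k P hk hm hP H
  have h1 : k.factorial * (5 * (m + 1)) ^ P < 4 ^ P * (m + 1) ^ k := by
    calc k.factorial * (5 * (m + 1)) ^ P = (k.factorial * 5 ^ P) * (m + 1) ^ P := by
          rw [mul_pow]; ring
      _ < (4 ^ P * b ^ (k - P)) * (m + 1) ^ P := Nat.mul_lt_mul_of_pos_right hc (by positivity)
      _ ≤ (4 ^ P * (m + 1) ^ (k - P)) * (m + 1) ^ P := by gcongr
      _ = 4 ^ P * ((m + 1) ^ (k - P) * (m + 1) ^ P) := by ring
      _ = 4 ^ P * (m + 1) ^ k := by rw [← pow_add, Nat.sub_add_cancel hPk]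
  omega

theorem hs_fact (k : ℕ) (hk : 1 ≤ k) :
    k.factorial * 2718 ^ k ≤ 3 * k * (1000 * k) ^ k := by
  have hk0 : (1 : ℝ) ≤ k := by exact_mod_cast hk
  have h : ((k.factorial : ℝ) * 2718 ^ k) ≤ 3 * k * (1000 * k) ^ k := by
    rw [← Real.log_le_log_iff (by positivity) (by positivity),
      Real.log_mul (by positivity) (by positivity), Real.log_mul (by positivity) (by positivity),
      Real.log_mul (by positivity) (by positivity), Real.log_pow, Real.log_pow,
      Real.log_mul (by positivity) (by positivity)]
    have h1 := hs_stirling_upper k hk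
    have h2 : Real.log 2718 ≤ 1 + Real.log 1000 := by
      have : Real.log (2718 / 1000) ≤ 1 := by
        rw [Real.log_le_iff_le_exp (by norm_num)]
        have := Real.exp_one_gt_d9
        norm_num at this ⊢
        linarith
      rw [Real.log_div (by norm_num) (by norm_num)] at this
      linarith
    have h3 : 1 ≤ Real.log 3 := by
      rw [Real.le_log_iff_exp_le (by norm_num)]
      linarith [Real.exp_one_lt_d9]
    have h4 : 0 ≤ Real.log (k : ℝ) := Real.log_natCast_nonneg k
    have h5 : (k : ℝ) * Real.log 2718 ≤ k * (1 + Real.log 1000) :=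
      mul_le_mul_of_nonneg_left h2 (by linarith)
    linarith
  exact_mod_cast h

theorem hs_block (m k a b P : ℕ) (ha : 1 ≤ a) (hk : a ≤ k) (hkb : k ≤ b) (hm : 4 * k ≤ m + 1)
    (hP : Nat.primeCounting (3 * b / 2) ≤ P) (hPa : P ≤ a)
    (hc : 3 * b * (5 * b) ^ P * 1000 ^ a < 10872 ^ a)
    (H : ∀ p : ℕ, p.Prime → (p ∣ ∏ i ∈ Finset.range k, (m + 1 + i)) → 2 * p ≤ 3 * k) :
    False := by
  have hk1 : 1 ≤ k := by omega
  refine hs_key2 m k P (4 * k) hk1 hm hm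
    ((Nat.monotone_primeCounting (by omega)).trans hP) (by omega) ?_ H
  have h1 := hs_fact k hk1
  have h2 : 3 * k * (5 * k) ^ P * 1000 ^ k < 10872 ^ k := by
    obtain ⟨d, rfl⟩ := Nat.exists_eq_add_of_le hk
    calc 3 * (a + d) * (5 * (a + d)) ^ P * 1000 ^ (a + d)
        ≤ 3 * b * (5 * b) ^ P * 1000 ^ (a + d) := by gcongr
      _ = 3 * b * (5 * b) ^ P * 1000 ^ a * 1000 ^ d := by rw [pow_add]; ring
      _ < 10872 ^ a * 1000 ^ d := Nat.mul_lt_mul_of_pos_right hc (by positivity)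
      _ ≤ 10872 ^ a * 10872 ^ d := by gcongr; norm_num
      _ = 10872 ^ (a + d) := by rw [pow_add]
  have h3 : k.factorial * (5 * k) ^ P < (4 * k) ^ k := by
    refine lt_of_mul_lt_mul_right ?_ (Nat.zero_le (2718 ^ k))
    calc k.factorial * (5 * k) ^ P * 2718 ^ k = (k.factorial * 2718 ^ k) * (5 * k) ^ P := by ring
      _ ≤ (3 * k * (1000 * k) ^ k) * (5 * k) ^ P := by gcongr
      _ = k ^ k * (3 * k * (5 * k) ^ P * 1000 ^ k) := by rw [mul_pow 1000 k k]; ring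
      _ < k ^ k * 10872 ^ k := Nat.mul_lt_mul_of_pos_left h2 (by positivity)
      _ = (4 * k) ^ k * 2718 ^ k := by
        rw [← mul_pow, ← mul_pow, show k * 10872 = 4 * k * 2718 by ring]
  refine lt_of_mul_lt_mul_right ?_ (Nat.zero_le (k ^ P))
  calc k.factorial * 5 ^ P * k ^ P = k.factorial * (5 * k) ^ P := by rw [mul_pow]; ring
    _ < (4 * k) ^ k := h3
    _ = (4 * k) ^ (k - P) * (4 * k) ^ P := by
      rw [← pow_add, Nat.sub_add_cancel (by omega)]
    _ = 4 ^ P * (4 * k) ^ (k - P) * k ^ P := by rw [mul_pow 4 k P]; ring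

/-- Product of the primes up to 73. -/
def hsQ : ℕ := 40729680599249024150621323470

def hsCount (y d : ℕ) : ℕ := (List.range' (y + 1) d).countP fun m => Nat.gcd m hsQ == 1

theorem hs_coprime (p : ℕ) (hp : p.Prime) (h : 73 < p) : Nat.gcd p hsQ = 1 := by
  have : Nat.Coprime p hsQ := by
    rw [Nat.Prime.coprime_iff_not_dvd hp]
    intro hd
    have hQ : hsQ = ([2, 3, 5, 7, 11, 13, 17, 19, 23, 29, 31, 37, 41, 43, 47, 53, 59, 61, 67, 71, 73] : List ℕ).prod := by
      unfold hsQ; norm_num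
    rw [hQ, hp.prime.dvd_prod_iff] at hd
    obtain ⟨a, ha, hpa⟩ := hd
    have h0 : ∀ a ∈ ([2, 3, 5, 7, 11, 13, 17, 19, 23, 29, 31, 37, 41, 43, 47, 53, 59, 61, 67, 71, 73] : List ℕ), 0 < a ∧ a ≤ 73 := by decide
    have := Nat.le_of_dvd (h0 a ha).1 hpa
    have := (h0 a ha).2
    omega
  exact this

theorem hs_step {y d P e : ℕ} (h : Nat.primeCounting y ≤ P) (hy : 73 ≤ y)
    (hc : hsCount y d ≤ e) : Nat.primeCounting (y + d) ≤ P + e := by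
  have hmain : ∀ d, Nat.primeCounting (y + d) ≤ Nat.primeCounting y + hsCount y d := by
    intro d
    induction d with
    | zero => simp
    | succ d ih =>
      have e1 : hsCount y (d + 1) = hsCount y d +
          if Nat.gcd (y + 1 + d) hsQ = 1 then 1 else 0 := by
        unfold hsCount
        rw [List.range'_concat, List.countP_append]
        simp
      have e2 : Nat.primeCounting (y + (d + 1)) = Nat.primeCounting (y + d) +
          if (y + 1 + d).Prime then 1 else 0 := by
        rw [Nat.primeCounting, Nat.primeCounting, Nat.primeCounting', Nat.count_succ]
        rw [show y + (d + 1) = y + d + 1 by ring, show y + 1 + d = y + d + 1 by ring]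
      rw [e1, e2]
      by_cases hp : (y + 1 + d).Prime
      · rw [if_pos hp, if_pos (hs_coprime _ hp (by omega))]; omega
      · rw [if_neg hp]; omega
  have := hmain d
  omega

theorem hs_case_medium (m k : ℕ) (hk : 100 ≤ k) (hk2 : k < 4096) (hm : 4 * k ≤ m + 1)
    (H : ∀ p : ℕ, p.Prime → (p ∣ ∏ i ∈ Finset.range k, (m + 1 + i)) → 2 * p ≤ 3 * k) :
    False := by
  have p0 : Nat.primeCounting 162 ≤ 37 := by decide +kernel
  have p1 : Nat.primeCounting 172 ≤ 39 :=
    hs_step (d := 10) (e := 2) p0 (by norm_num) (by decide +kernel)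
  have p2 : Nat.primeCounting 189 ≤ 42 :=
    hs_step (d := 17) (e := 3) p1 (by norm_num) (by decide +kernel)
  have p3 : Nat.primeCounting 198 ≤ 45 :=
    hs_step (d := 9) (e := 3) p2 (by norm_num) (by decide +kernel)
  have p4 : Nat.primeCounting 222 ≤ 47 :=
    hs_step (d := 24) (e := 2) p3 (by norm_num) (by decide +kernel)
  have p5 : Nat.primeCounting 240 ≤ 52 :=
    hs_step (d := 18) (e := 5) p4 (by norm_num) (by decide +kernel)
  have p6 : Nat.primeCounting 262 ≤ 55 :=
    hs_step (d := 22) (e := 3) p5 (by norm_num) (by decide +kernel)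
  have p7 : Nat.primeCounting 282 ≤ 60 :=
    hs_step (d := 20) (e := 5) p6 (by norm_num) (by decide +kernel)
  have p8 : Nat.primeCounting 310 ≤ 63 :=
    hs_step (d := 28) (e := 3) p7 (by norm_num) (by decide +kernel)
  have p9 : Nat.primeCounting 348 ≤ 69 :=
    hs_step (d := 38) (e := 6) p8 (by norm_num) (by decide +kernel)
  have p10 : Nat.primeCounting 388 ≤ 76 :=
    hs_step (d := 40) (e := 7) p9 (by norm_num) (by decide +kernel)
  have p11 : Nat.primeCounting 438 ≤ 84 :=
    hs_step (d := 50) (e := 8) p10 (by norm_num) (by decide +kernel)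
  have p12 : Nat.primeCounting 490 ≤ 93 :=
    hs_step (d := 52) (e := 9) p11 (by norm_num) (by decide +kernel)
  have p13 : Nat.primeCounting 562 ≤ 102 :=
    hs_step (d := 72) (e := 9) p12 (by norm_num) (by decide +kernel)
  have p14 : Nat.primeCounting 642 ≤ 116 :=
    hs_step (d := 80) (e := 14) p13 (by norm_num) (by decide +kernel)
  have p15 : Nat.primeCounting 738 ≤ 130 :=
    hs_step (d := 96) (e := 14) p14 (by norm_num) (by decide +kernel)
  have p16 : Nat.primeCounting 852 ≤ 146 :=
    hs_step (d := 114) (e := 16) p15 (by norm_num) (by decide +kernel)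
  have p17 : Nat.primeCounting 990 ≤ 166 :=
    hs_step (d := 138) (e := 20) p16 (by norm_num) (by decide +kernel)
  have p18 : Nat.primeCounting 1152 ≤ 190 :=
    hs_step (d := 162) (e := 24) p17 (by norm_num) (by decide +kernel)
  have p19 : Nat.primeCounting 1360 ≤ 217 :=
    hs_step (d := 208) (e := 27) p18 (by norm_num) (by decide +kernel)
  have p20 : Nat.primeCounting 1600 ≤ 251 :=
    hs_step (d := 240) (e := 34) p19 (by norm_num) (by decide +kernel)
  have p21 : Nat.primeCounting 1900 ≤ 290 :=
    hs_step (d := 300) (e := 39) p20 (by norm_num) (by decide +kernel)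
  have p22 : Nat.primeCounting 2272 ≤ 337 :=
    hs_step (d := 372) (e := 47) p21 (by norm_num) (by decide +kernel)
  have p23 : Nat.primeCounting 2718 ≤ 396 :=
    hs_step (d := 446) (e := 59) p22 (by norm_num) (by decide +kernel)
  have p24 : Nat.primeCounting 3300 ≤ 463 :=
    hs_step (d := 582) (e := 67) p23 (by norm_num) (by decide +kernel)
  have p25 : Nat.primeCounting 4002 ≤ 551 :=
    hs_step (d := 702) (e := 88) p24 (by norm_num) (by decide +kernel)
  have p26 : Nat.primeCounting 4908 ≤ 655 :=
    hs_step (d := 906) (e := 104) p25 (by norm_num) (by decide +kernel)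
  have p27 : Nat.primeCounting 6042 ≤ 787 :=
    hs_step (d := 1134) (e := 132) p26 (by norm_num) (by decide +kernel)
  have p28 : Nat.primeCounting 6150 ≤ 801 :=
    hs_step (d := 108) (e := 14) p27 (by norm_num) (by decide +kernel)
  rcases le_or_gt k 108 with h0 | h0
  · exact hs_block m k 100 108 37 (by norm_num) (by omega) h0 hm p0 (by norm_num)
      (by decide +kernel) H
  rcases le_or_gt k 115 with h1 | h1
  · exact hs_block m k 109 115 39 (by norm_num) (by omega) h1 hm p1 (by norm_num)
      (by decide +kernel) H
  rcases le_or_gt k 126 with h2 | h2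
  · exact hs_block m k 116 126 42 (by norm_num) (by omega) h2 hm p2 (by norm_num)
      (by decide +kernel) H
  rcases le_or_gt k 132 with h3 | h3
  · exact hs_block m k 127 132 45 (by norm_num) (by omega) h3 hm p3 (by norm_num)
      (by decide +kernel) H
  rcases le_or_gt k 148 with h4 | h4
  · exact hs_block m k 133 148 47 (by norm_num) (by omega) h4 hm p4 (by norm_num)
      (by decide +kernel) H
  rcases le_or_gt k 160 with h5 | h5
  · exact hs_block m k 149 160 52 (by norm_num) (by omega) h5 hm p5 (by norm_num)
      (by decide +kernel) H
  rcases le_or_gt k 175 with h6 | h6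
  · exact hs_block m k 161 175 55 (by norm_num) (by omega) h6 hm p6 (by norm_num)
      (by decide +kernel) H
  rcases le_or_gt k 188 with h7 | h7
  · exact hs_block m k 176 188 60 (by norm_num) (by omega) h7 hm p7 (by norm_num)
      (by decide +kernel) H
  rcases le_or_gt k 207 with h8 | h8
  · exact hs_block m k 189 207 63 (by norm_num) (by omega) h8 hm p8 (by norm_num)
      (by decide +kernel) H
  rcases le_or_gt k 232 with h9 | h9
  · exact hs_block m k 208 232 69 (by norm_num) (by omega) h9 hm p9 (by norm_num)
      (by decide +kernel) H
  rcases le_or_gt k 259 with h10 | h10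
  · exact hs_block m k 233 259 76 (by norm_num) (by omega) h10 hm p10 (by norm_num)
      (by decide +kernel) H
  rcases le_or_gt k 292 with h11 | h11
  · exact hs_block m k 260 292 84 (by norm_num) (by omega) h11 hm p11 (by norm_num)
      (by decide +kernel) H
  rcases le_or_gt k 327 with h12 | h12
  · exact hs_block m k 293 327 93 (by norm_num) (by omega) h12 hm p12 (by norm_num)
      (by decide +kernel) H
  rcases le_or_gt k 375 with h13 | h13
  · exact hs_block m k 328 375 102 (by norm_num) (by omega) h13 hm p13 (by norm_num)
      (by decide +kernel) H
  rcases le_or_gt k 428 with h14 | h14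
  · exact hs_block m k 376 428 116 (by norm_num) (by omega) h14 hm p14 (by norm_num)
      (by decide +kernel) H
  rcases le_or_gt k 492 with h15 | h15
  · exact hs_block m k 429 492 130 (by norm_num) (by omega) h15 hm p15 (by norm_num)
      (by decide +kernel) H
  rcases le_or_gt k 568 with h16 | h16
  · exact hs_block m k 493 568 146 (by norm_num) (by omega) h16 hm p16 (by norm_num)
      (by decide +kernel) H
  rcases le_or_gt k 660 with h17 | h17
  · exact hs_block m k 569 660 166 (by norm_num) (by omega) h17 hm p17 (by norm_num)
      (by decide +kernel) H
  rcases le_or_gt k 768 with h18 | h18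
  · exact hs_block m k 661 768 190 (by norm_num) (by omega) h18 hm p18 (by norm_num)
      (by decide +kernel) H
  rcases le_or_gt k 907 with h19 | h19
  · exact hs_block m k 769 907 217 (by norm_num) (by omega) h19 hm p19 (by norm_num)
      (by decide +kernel) H
  rcases le_or_gt k 1067 with h20 | h20
  · exact hs_block m k 908 1067 251 (by norm_num) (by omega) h20 hm p20 (by norm_num)
      (by decide +kernel) H
  rcases le_or_gt k 1267 with h21 | h21
  · exact hs_block m k 1068 1267 290 (by norm_num) (by omega) h21 hm p21 (by norm_num)
      (by decide +kernel) H
  rcases le_or_gt k 1515 with h22 | h22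
  · exact hs_block m k 1268 1515 337 (by norm_num) (by omega) h22 hm p22 (by norm_num)
      (by decide +kernel) H
  rcases le_or_gt k 1812 with h23 | h23
  · exact hs_block m k 1516 1812 396 (by norm_num) (by omega) h23 hm p23 (by norm_num)
      (by decide +kernel) H
  rcases le_or_gt k 2200 with h24 | h24
  · exact hs_block m k 1813 2200 463 (by norm_num) (by omega) h24 hm p24 (by norm_num)
      (by decide +kernel) H
  rcases le_or_gt k 2668 with h25 | h25
  · exact hs_block m k 2201 2668 551 (by norm_num) (by omega) h25 hm p25 (by norm_num)
      (by decide +kernel) H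
  rcases le_or_gt k 3272 with h26 | h26
  · exact hs_block m k 2669 3272 655 (by norm_num) (by omega) h26 hm p26 (by norm_num)
      (by decide +kernel) H
  rcases le_or_gt k 4028 with h27 | h27
  · exact hs_block m k 3273 4028 787 (by norm_num) (by omega) h27 hm p27 (by norm_num)
      (by decide +kernel) H
  rcases le_or_gt k 4100 with h28 | h28
  · exact hs_block m k 4029 4100 801 (by norm_num) (by omega) h28 hm p28 (by norm_num)
      (by decide +kernel) H
  omega

theorem hs_small_table : ∀ k < 100, 3 ≤ k → Nat.primeCounting (3 * k / 2) ≤ k ∧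
    k.factorial * 5 ^ Nat.primeCounting (3 * k / 2) < 4 ^ Nat.primeCounting (3 * k / 2) *
      (if k < 50 then max (4 * k) 300 else 4 * k) ^ (k - Nat.primeCounting (3 * k / 2)) := by
  decide +kernel

theorem hs_case_small (m k : ℕ) (hk : 3 ≤ k) (hk2 : k < 100) (hm : 4 * k ≤ m + 1)
    (hm2 : k < 50 → 300 ≤ m + 1)
    (H : ∀ p : ℕ, p.Prime → (p ∣ ∏ i ∈ Finset.range k, (m + 1 + i)) → 2 * p ≤ 3 * k) :
    False := by
  obtain ⟨h1, h2⟩ := hs_small_table k hk2 hk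
  refine hs_key2 m k _ _ (by omega) hm ?_ le_rfl h1 h2 H
  split_ifs with h
  · exact max_le hm (hm2 h)
  · exact hm

/-- Does some `n + i` with `i < k` have a prime factor, taken from the list, above `3k/2`? -/
def hsHas (n k : ℕ) : Bool :=
  ([2, 3, 5, 7, 11, 13, 17, 19, 23, 29, 31, 37, 41, 43, 47, 53, 59, 61, 67, 71, 73, 79, 83, 89, 97, 101, 103, 107, 109, 113, 127, 131, 137, 139, 149, 151, 157, 163, 167, 173, 179, 181, 191, 193, 197, 199, 211, 223, 227, 229, 233, 239, 241, 251, 257, 263, 269, 271, 277, 281, 283, 293, 307, 311, 313, 317, 331, 337, 347, 349, 353, 359] : List ℕ).any fun p => Nat.blt (3 * k) (2 * p) && Nat.ble n ((n + k - 1) / p * p)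

theorem hs_tiny_table : ∀ k < 50, ∀ n < 300, (Nat.ble k 2 || Nat.ble n k ||
    (Nat.beq n 6 && Nat.beq k 5) || hsHas n k) = true := by
  decide +kernel

theorem hs_dvd_of_multiple (n k p : ℕ) (hk : 1 ≤ k) (h : n ≤ (n + k - 1) / p * p) :
    p ∣ ∏ i ∈ Finset.range k, (n + i) := by
  have h2 : (n + k - 1) / p * p ≤ n + k - 1 := Nat.div_mul_le_self _ _
  have h3 : (n + k - 1) / p * p - n ∈ Finset.range k := by
    rw [Finset.mem_range]; omega
  refine Dvd.dvd.trans ?_ (Finset.dvd_prod_of_mem (fun i => n + i) h3)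
  rw [show n + ((n + k - 1) / p * p - n) = (n + k - 1) / p * p by omega]
  exact Dvd.intro_left _ rfl

theorem hs_plist_prime : ∀ p ∈ ([2, 3, 5, 7, 11, 13, 17, 19, 23, 29, 31, 37, 41, 43, 47, 53, 59, 61, 67, 71, 73, 79, 83, 89, 97, 101, 103, 107, 109, 113, 127, 131, 137, 139, 149, 151, 157, 163, 167, 173, 179, 181, 191, 193, 197, 199, 211, 223, 227, 229, 233, 239, 241, 251, 257, 263, 269, 271, 277, 281, 283, 293, 307, 311, 313, 317, 331, 337, 347, 349, 353, 359] : List ℕ), p.Prime := by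
  intro p hp
  simp only [List.mem_cons, List.not_mem_nil, or_false] at hp
  rcases hp with rfl | rfl | rfl | rfl | rfl | rfl | rfl | rfl | rfl | rfl | rfl | rfl | rfl | rfl | rfl | rfl | rfl | rfl | rfl | rfl | rfl | rfl | rfl | rfl | rfl | rfl | rfl | rfl | rfl | rfl | rfl | rfl | rfl | rfl | rfl | rfl | rfl | rfl | rfl | rfl | rfl | rfl | rfl | rfl | rfl | rfl | rfl | rfl | rfl | rfl | rfl | rfl | rfl | rfl | rfl | rfl | rfl | rfl | rfl | rfl | rfl | rfl | rfl | rfl | rfl | rfl | rfl | rfl | rfl | rfl | rfl | rfl <;> norm_num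

theorem hs_case_tiny (n k : ℕ) (hk : 3 ≤ k) (hk2 : k < 50) (hn : n < 300) (hkn : k < n)
    (hex : ¬ (n = 6 ∧ k = 5)) :
    ∃ p : ℕ, p.Prime ∧ (p ∣ ∏ i ∈ Finset.range k, (n + i)) ∧ 3 * k < 2 * p := by
  have h := hs_tiny_table k hk2 n hn
  rw [Bool.or_eq_true, Bool.or_eq_true, Bool.or_eq_true, Bool.and_eq_true] at h
  replace h : hsHas n k = true := by
    rcases h with ((h | h) | h) | h
    · have := Nat.le_of_ble_eq_true h
      omega
    · have := Nat.le_of_ble_eq_true h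
      omega
    · exact absurd ⟨Nat.eq_of_beq_eq_true h.1, Nat.eq_of_beq_eq_true h.2⟩ hex
    · exact h
  unfold hsHas at h
  rw [List.any_eq_true] at h
  obtain ⟨p, hp, h2⟩ := h
  rw [Bool.and_eq_true] at h2
  refine ⟨p, hs_plist_prime p hp, ?_, Nat.blt_eq.mp h2.1⟩
  exact hs_dvd_of_multiple n k p (by omega) (Nat.le_of_ble_eq_true h2.2)

theorem hs_dvd_of_mem (n k p : ℕ) (h1 : n ≤ p) (h2 : p < n + k) :
    p ∣ ∏ i ∈ Finset.range k, (n + i) := by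
  have h3 : p - n ∈ Finset.range k := by rw [Finset.mem_range]; omega
  refine Dvd.dvd.trans ?_ (Finset.dvd_prod_of_mem (fun i => n + i) h3)
  rw [show n + (p - n) = p by omega]

theorem hs_case_near (n k : ℕ) (hk : 50 ≤ k) (hkn : k < n) (hn : n < 4 * k) :
    ∃ p : ℕ, p.Prime ∧ (p ∣ ∏ i ∈ Finset.range k, (n + i)) ∧ 3 * k < 2 * p := by
  obtain ⟨p, hp, h1, h2⟩ := hs_prime_between (max (n - 1) (3 * k / 2)) (by omega)
  refine ⟨p, hp, hs_dvd_of_mem n k p (by omega) (by omega), by omega⟩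

theorem hs_two_pow (a b : ℕ) (h : 3 ^ b + 1 = 2 ^ a) : 2 ^ a ≤ 4 := by
  by_contra hc
  push Not at hc
  have ha : 3 ≤ a := by
    by_contra h3
    have : a ≤ 2 := by omega
    have := Nat.pow_le_pow_right (n := 2) (by norm_num) this
    omega
  have h8 : 8 ∣ 2 ^ a := by
    have := pow_dvd_pow 2 ha
    norm_num at this
    exact this
  have h9 : 3 ^ b % 8 = 1 ∨ 3 ^ b % 8 = 3 := by
    clear h
    induction b with
    | zero => simp
    | succ b ih => rw [pow_succ]; omega
  omega

theorem hs_three_pow (a b : ℕ) (h : 2 ^ a + 1 = 3 ^ b) : 2 ^ a ≤ 2 ∨ 2 ^ a = 8 := by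
  by_contra hc
  push Not at hc
  obtain ⟨hc1, hc2⟩ := hc
  have ha : 2 ≤ a := by
    by_contra h3
    have : a ≤ 1 := by omega
    have := Nat.pow_le_pow_right (n := 2) (by norm_num) this
    omega
  have h4 : 4 ∣ 2 ^ a := by
    have := pow_dvd_pow 2 ha
    norm_num at this
    exact this
  rcases Nat.even_or_odd' b with ⟨c, rfl | rfl⟩
  · -- b = 2c
    have hx1 : 1 ≤ 3 ^ c := Nat.one_le_pow _ _ (by norm_num)
    obtain ⟨y, hy⟩ : ∃ y, 3 ^ c = y + 1 := ⟨3 ^ c - 1, by omega⟩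
    have hfac : y * (y + 2) = 2 ^ a := by
      have : 3 ^ (2 * c) = (y + 1) * (y + 1) := by rw [mul_comm, pow_mul, hy, sq]
      have e : y * (y + 2) + 1 = (y + 1) * (y + 1) := by ring
      omega
    obtain ⟨i, -, hi⟩ := (Nat.dvd_prime_pow Nat.prime_two).1 (Dvd.intro _ hfac)
    have : 3 ^ c + 1 = y + 2 := by omega
    obtain ⟨j, -, hj⟩ := (Nat.dvd_prime_pow Nat.prime_two).1 (Dvd.intro_left _ hfac)
    rw [hj] at this
    have := hs_two_pow j c this
    have hy2 : y ≤ 2 := by omega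
    interval_cases y
    · norm_num at hfac; have : 0 < 2 ^ a := by positivity
      omega
    · norm_num at hfac; omega
    · norm_num at hfac; omega
  · have h9 : 3 ^ (2 * c + 1) % 4 = 3 := by
      clear h
      induction c with
      | zero => simp
      | succ c ih => rw [show 2 * (c + 1) + 1 = 2 * c + 1 + 2 by ring, pow_add]; omega
    omega

theorem hs_prime_le_three {p : ℕ} (hp : p.Prime) (h : 2 * p ≤ 6) : p = 2 ∨ p = 3 := by
  have := hp.two_le
  omega

theorem hs_pow_of_odd (x q r : ℕ) (hx : x ≠ 0) (hq : ¬ q ∣ x)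
    (h : ∀ p : ℕ, p.Prime → p ∣ x → p = q ∨ p = r) : ∃ a, x = r ^ a := by
  refine ⟨_, Nat.eq_prime_pow_of_unique_prime_dvd hx ?_⟩
  intro d hd hdx
  rcases h d hd hdx with rfl | rfl
  · exact absurd hdx hq
  · rfl

theorem hs_case_two (n : ℕ) (hn : 2 < n) (h3 : n ≠ 3) (h8 : n ≠ 8) :
    ∃ p : ℕ, p.Prime ∧ (p ∣ ∏ i ∈ Finset.range 2, (n + i)) ∧ 3 * 2 < 2 * p := by
  by_contra hcon
  push Not at hcon
  have hpr : ∏ i ∈ Finset.range 2, (n + i) = n * (n + 1) := by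
    simp [Finset.prod_range_succ]
  rw [hpr] at hcon
  have g1 : ∀ p : ℕ, p.Prime → p ∣ n → p = 2 ∨ p = 3 := fun p hp hd =>
    hs_prime_le_three hp (hcon p hp (hd.mul_right _))
  have g2 : ∀ p : ℕ, p.Prime → p ∣ n + 1 → p = 2 ∨ p = 3 := fun p hp hd =>
    hs_prime_le_three hp (hcon p hp (hd.mul_left _))
  have g1' := fun p hp hd => (g1 p hp hd).symm
  have g2' := fun p hp hd => (g2 p hp hd).symm
  rcases Nat.even_or_odd n with he | ho
  · have h2n : 2 ∣ n := he.two_dvd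
    obtain ⟨b, hb⟩ := hs_pow_of_odd (n + 1) 2 3 (by omega) (by omega) g2
    have h3n : ¬ 3 ∣ n := by
      intro h
      rcases Nat.eq_zero_or_pos b with rfl | hb0
      · simp at hb; omega
      · have : 3 ∣ n + 1 := by rw [hb]; exact dvd_pow_self 3 (by omega)
        omega
    obtain ⟨a, ha⟩ := hs_pow_of_odd n 3 2 (by omega) h3n g1'
    have := hs_three_pow a b (by omega)
    omega
  · obtain ⟨c, hc⟩ := ho
    obtain ⟨b, hb⟩ := hs_pow_of_odd n 2 3 (by omega) (by omega) g1
    have h3n : ¬ 3 ∣ n + 1 := by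
      intro h
      rcases Nat.eq_zero_or_pos b with rfl | hb0
      · simp at hb; omega
      · have : 3 ∣ n := by rw [hb]; exact dvd_pow_self 3 (by omega)
        omega
    obtain ⟨a, ha⟩ := hs_pow_of_odd (n + 1) 3 2 (by omega) h3n g2'
    have := hs_two_pow a b (by omega)
    omega

/-- Hanson's theorem: for `n > ℓ ≥ 1`, the product `n(n+1)⋯(n+ℓ-1)` has a prime
divisor greater than `3ℓ/2`, except for `3·4`, `8·9`, and `6·7·8·9·10`. -/
theorem stmt_9 (n ℓ : ℕ) (h1 : 1 ≤ ℓ) (h2 : ℓ < n)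
    (hex : ¬ ((n = 3 ∧ ℓ = 2) ∨ (n = 8 ∧ ℓ = 2) ∨ (n = 6 ∧ ℓ = 5))) :
    ∃ p : ℕ, p.Prime ∧ (p ∣ ∏ i ∈ Finset.range ℓ, (n + i)) ∧ 3 * ℓ < 2 * p := by
  rcases (by omega : ℓ = 1 ∨ ℓ = 2 ∨ 3 ≤ ℓ) with rfl | rfl | h3
  · obtain ⟨p, hp, hd⟩ := Nat.exists_prime_and_dvd (n := n) (by omega)
    refine ⟨p, hp, ?_, ?_⟩
    · simpa using hd
    · have := hp.two_le
      omega
  · exact hs_case_two n h2 (by omega) (by omega)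
  · by_cases ht : ℓ < 50 ∧ n < 300
    · exact hs_case_tiny n ℓ h3 ht.1 ht.2 h2 (by tauto)
    by_cases hn : n < 4 * ℓ
    · exact hs_case_near n ℓ (by omega) h2 hn
    by_contra hcon
    push Not at hcon
    obtain ⟨m, rfl⟩ : ∃ m, n = m + 1 := ⟨n - 1, by omega⟩
    rcases lt_or_ge ℓ 100 with h100 | h100
    · exact hs_case_small m ℓ h3 h100 (by omega) (by omega) hcon
    rcases lt_or_ge ℓ 4096 with h4096 | h4096
    · exact hs_case_medium m ℓ h100 h4096 (by omega) hcon
    · exact hs_case_large m ℓ h4096 (by omega) hcon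
end
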